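/- The number of reduced words for the longest element w_0 of the type B_n Coxeter group equals the number of standard Young tableaux of n×n square shape, which in turn equals the number of standard shifted Young tableaux of doubled staircase shape (2n−1, 2n−3, …, 1): |R(w_0)| = |SYT(n×n)| = |SYT'(2n−1, 2n−3, …, 1)|. -/

import Mathlib

/-! ### Tableau machinery: fillings as functions `ℕ × ℕ → ℕ` (entry `0` = empty/absent cell) -/

/-- One jeu de taquin slide: starting from an empty box at position `c`, repeatedly swap the
empty box with the smaller of the entries directly to its right and directly below it
(`0` denotes an empty/absent cell), until neither exists.  Returns the resulting filling
together with the final position of the empty box; `fuel` bounds the number of steps. -/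
def jdtSlide : ℕ → ((ℕ × ℕ) → ℕ) → (ℕ × ℕ) → (((ℕ × ℕ) → ℕ) × (ℕ × ℕ))
  | 0, f, c => (f, c)
  | fuel+1, f, c =>
    let a := c.1
    let b := c.2
    let r := f (a, b+1)
    let d := f (a+1, b)
    if r = 0 ∧ d = 0 then (f, c)
    else if d = 0 ∨ (r ≠ 0 ∧ r < d) then
      jdtSlide fuel (Function.update (Function.update f (a, b+1) 0) (a, b) r) (a, b+1)
    else
      jdtSlide fuel (Function.update (Function.update f (a+1, b) 0) (a, b) d) (a+1, b)

/-- Jeu de taquin promotion of a standard filling with `N` boxes: delete the entry `1`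
(in the upper left corner `(0,0)`), decrease every other entry by `1`, slide the empty box
by jeu de taquin, and fill the final empty box with `N`. -/
def promote (N : ℕ) (f : (ℕ × ℕ) → ℕ) : (ℕ × ℕ) → ℕ :=
  let s := jdtSlide N (fun c => f c - 1) (0, 0)
  Function.update s.1 s.2 N

/-- The cells of the (straight-shape) Young diagram of a partition `lam`:
row `a` consists of the cells `(a, b)` with `b < lam a`. -/
def strCell (lam : List ℕ) (c : ℕ × ℕ) : Prop := c.2 < lam.getD c.1 0

/-- The cells of the shifted Young diagram of a strict partition `lam`:
row `a` consists of the cells `(a, b)` with `a ≤ b < a + lam a`. -/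
def shiftCell (lam : List ℕ) (c : ℕ × ℕ) : Prop :=
  c.1 ≤ c.2 ∧ c.2 < c.1 + lam.getD c.1 0

/-- `IsStdFilling cells N f` : `f` is a standard tableau on the cell set `cells` with
entries `1, …, N`: it vanishes off `cells`, restricts to a bijection `cells → {1, …, N}`,
and is strictly increasing along rows and columns. -/
def IsStdFilling (cells : ℕ × ℕ → Prop) (N : ℕ) (f : (ℕ × ℕ) → ℕ) : Prop :=
  (∀ c, ¬ cells c → f c = 0) ∧
  (∀ c, cells c → 1 ≤ f c ∧ f c ≤ N) ∧
  (∀ c c', cells c → cells c' → f c = f c' → c = c') ∧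
  (∀ v, 1 ≤ v → v ≤ N → ∃ c, cells c ∧ f c = v) ∧
  (∀ a b, cells (a, b) → cells (a, b+1) → f (a, b) < f (a, b+1)) ∧
  (∀ a b, cells (a, b) → cells (a+1, b) → f (a, b) < f (a+1, b))

/-- The rectangular partition with `b` rows and `n` columns. -/
def rectShape (b n : ℕ) : List ℕ := List.replicate b n

/-- The square partition with `n` rows and `n` columns. -/
def sqShape (n : ℕ) : List ℕ := List.replicate n n

/-- The doubled staircase strict partition `(2n-1, 2n-3, …, 1)`. -/
def dblStair (n : ℕ) : List ℕ := (List.range n).map (fun i => 2*n - 1 - 2*i)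

/-- The index of the row containing the entry `v` of a filling
(rows numbered `0, 1, 2, …` from the top). -/
noncomputable def rowOf (f : (ℕ × ℕ) → ℕ) (v : ℕ) : ℕ := sInf {a | ∃ b, f (a, b) = v}

namespace BW

open Equiv


lemma inv_app (v : Perm ℤ) (x : ℤ) : v⁻¹ (v x) = x := v.symm_apply_apply x

lemma app_inv (v : Perm ℤ) (x : ℤ) : v (v⁻¹ x) = x := v.apply_symm_apply x

/-- the (signed) reflection swapping `a` with `b` and `-a` with `-b` -/
def T (a b : ℤ) : Perm ℤ := if a = -b then swap a b else swap a b * swap (-a) (-b)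

lemma T_apply {a b : ℤ} (ha : a ≠ 0) (hb : b ≠ 0) (x : ℤ) :
    T a b x = if x = a then b else if x = b then a else if x = -a then -b
      else if x = -b then -a else x := by
  unfold T
  split_ifs <;> simp only [Perm.mul_apply, swap_apply_def] <;> grind

/-- lower value of the `k`-th simple reflection -/
def lo (k : ℕ) : ℤ := if k = 0 then -1 else k

lemma lo_ne (k : ℕ) : lo k ≠ 0 := by unfold lo; split_ifs <;> omega

lemma hi_ne (k : ℕ) : (k : ℤ) + 1 ≠ 0 := by omega

/-- simple reflections -/
def s (k : ℕ) : Perm ℤ := T (lo k) (k + 1)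

lemma s_apply (k : ℕ) (x : ℤ) :
    s k x = if x = lo k then (k : ℤ) + 1 else if x = k + 1 then lo k else if x = - lo k then -(k + 1)
      else if x = -(k + 1) then - lo k else x :=
  T_apply (lo_ne k) (hi_ne k) x

lemma T_mul_self {a b : ℤ} (ha : a ≠ 0) (hb : b ≠ 0) : T a b * T a b = 1 := by
  ext x
  simp only [Perm.mul_apply, T_apply ha hb, Perm.one_apply]
  grind

lemma s_mul_self (k : ℕ) : s k * s k = 1 := T_mul_self (lo_ne k) (hi_ne k)

lemma s_mul_s_mul (k : ℕ) (v : Perm ℤ) : s k * (s k * v) = v := by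
  rw [← mul_assoc, s_mul_self, one_mul]

lemma mul_T_T {a b : ℤ} (ha : a ≠ 0) (hb : b ≠ 0) (v : Perm ℤ) : v * T a b * T a b = v := by
  rw [mul_assoc, T_mul_self ha hb, mul_one]

lemma s_inv (k : ℕ) : (s k)⁻¹ = s k := inv_eq_of_mul_eq_one_left (s_mul_self k)

lemma T_comm (a b : ℤ) : T a b = T b a := by
  unfold T
  have : a = -b ↔ b = -a := by omega
  simp only [this, swap_comm b a, swap_comm (-b) (-a)]

lemma T_neg {a b : ℤ} (ha : a ≠ 0) (hb : b ≠ 0) : T (-a) (-b) = T a b := by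
  ext x
  rw [T_apply ha hb, T_apply (by omega) (by omega)]
  grind

/-- the group of signed permutations of `[-K, K]` -/
def Bn (K : ℕ) (v : Perm ℤ) : Prop := (∀ i, v (-i) = - v i) ∧ ∀ i, (K : ℤ) < i → v i = i

lemma Bn.zero {K : ℕ} {v : Perm ℤ} (h : Bn K v) : v 0 = 0 := by
  have := h.1 0
  simp at this; omega

lemma Bn.ne {K : ℕ} {v : Perm ℤ} (h : Bn K v) {i : ℤ} (hi : i ≠ 0) : v i ≠ 0 := by
  intro h0
  apply hi
  apply v.injective
  rw [h0, h.zero]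

lemma Bn.one (K : ℕ) : Bn K 1 := ⟨fun i => by simp, fun i _ => by simp⟩

lemma Bn.inv {K : ℕ} {v : Perm ℤ} (h : Bn K v) : Bn K v⁻¹ := by
  refine ⟨fun i => ?_, fun i hi => ?_⟩
  · rw [Perm.inv_eq_iff_eq, h.1]; simp
  · rw [Perm.inv_eq_iff_eq, h.2 i hi]

lemma Bn.mul {K : ℕ} {v w : Perm ℤ} (h : Bn K v) (h' : Bn K w) : Bn K (v * w) := by
  refine ⟨fun i => ?_, fun i hi => ?_⟩
  · simp [h.1, h'.1]
  · simp [h.2 i hi, h'.2 i hi]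

lemma Bn.mono {K L : ℕ} {v : Perm ℤ} (h : Bn K v) (hl : K ≤ L) : Bn L v :=
  ⟨h.1, fun i hi => h.2 i (by omega)⟩

lemma Bn_T {K : ℕ} {a b : ℤ} (ha : a ≠ 0) (hb : b ≠ 0) (h1 : |a| ≤ K) (h2 : |b| ≤ K) :
    Bn K (T a b) := by
  rw [abs_le] at h1 h2
  refine ⟨fun i => ?_, fun i hi => ?_⟩
  · simp only [T_apply ha hb]; grind
  · simp only [T_apply ha hb]; grind

lemma Bn_s {K k : ℕ} (h : k < K) : Bn K (s k) := by
  apply Bn_T (lo_ne k) (hi_ne k)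
  · rw [abs_le]; unfold lo; split_ifs <;> omega
  · rw [abs_le]; omega

lemma Bn.range {K : ℕ} {v : Perm ℤ} (h : Bn K v) {i : ℤ} (hi : |i| ≤ K) : |v i| ≤ K := by
  rw [abs_le] at *
  constructor
  · by_contra hc
    have h1 := h.2 (v (-i)) (by rw [h.1]; omega)
    have := v.injective h1
    rw [h.1] at this
    omega
  · by_contra hc
    have h1 := h.2 (v i) (by omega)
    have := v.injective h1
    omega

lemma conj {K : ℕ} {v : Perm ℤ} (h : Bn K v) (a b : ℤ) : v * T a b = T (v a) (v b) * v := by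
  have : v a = - v b ↔ a = -b := by
    rw [← h.1]; exact v.injective.eq_iff
  unfold T
  simp only [this]
  split_ifs
  · rw [mul_swap_eq_swap_mul]
  · rw [← mul_assoc, mul_swap_eq_swap_mul v a b, mul_assoc, mul_swap_eq_swap_mul v (-a) (-b), h.1, h.1,
      mul_assoc]

/-- inversions -/
def Inv (v : Perm ℤ) : Set (ℤ × ℤ) := {p | p.1 ≠ 0 ∧ -p.2 ≤ p.1 ∧ p.1 < p.2 ∧ v p.2 < v p.1}

lemma Inv_finite {K : ℕ} {v : Perm ℤ} (h : Bn K v) : (Inv v).Finite := by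
  apply Set.Finite.subset ((Set.finite_Icc (-(K:ℤ)) K).prod (Set.finite_Icc (-(K:ℤ)) K))
  rintro ⟨i, j⟩ ⟨h1, h2, h3, h4⟩
  simp only at h1 h2 h3 h4
  have : j ≤ K := by
    by_contra hc
    rw [h.2 j (by omega)] at h4
    by_cases hi : |i| ≤ K
    · have := h.range hi
      rw [abs_le] at this
      omega
    · rw [abs_le] at hi
      by_cases hp : 0 < i
      · rw [h.2 i (by omega)] at h4; omega
      · have := h.2 (-i) (by omega)
        rw [h.1] at this; omega
  simp only [Set.mem_prod, Set.mem_Icc]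
  omega

/-- length -/
noncomputable def ell (v : Perm ℤ) : ℕ := (Inv v).ncard

/-- left descent -/
def desc (k : ℕ) (v : Perm ℤ) : Prop := v⁻¹ (k + 1) < v⁻¹ (lo k)

lemma s_flip (k : ℕ) {x y : ℤ} (hx : x ≠ 0) (hy : y ≠ 0) (h : x < y) (h' : s k y < s k x) :
    (x = lo k ∧ y = k + 1) ∨ (x = -(k+1) ∧ y = - lo k) := by
  rw [s_apply, s_apply] at h'
  unfold lo at *
  by_cases hk : k = 0
  · subst hk; simp at *; grind
  · simp only [hk, if_false] at *
    split_ifs at h' <;> omega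

lemma s_flip_T (k : ℕ) {x y : ℤ} (hx : x ≠ 0) (hy : y ≠ 0) (h : x < y) (h' : s k y < s k x) :
    T x y = s k := by
  rcases s_flip k hx hy h h' with ⟨rfl, rfl⟩ | ⟨rfl, rfl⟩
  · rfl
  · rw [T_neg (hi_ne k) (lo_ne k), T_comm]; rfl

lemma lo_lt (k : ℕ) : lo k < k + 1 := by unfold lo; split_ifs <;> omega

lemma s_hi (k : ℕ) : s k (k + 1) = lo k := by
  have := lo_lt k
  rw [s_apply, if_neg (by omega), if_pos rfl]

lemma ell_desc {K k : ℕ} {v : Perm ℤ} (h : Bn K v) (hk : k < K) (hd : desc k v) :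
    ell v = ell (s k * v) + 1 := by
  have hB : Bn K (s k * v) := (Bn_s hk).mul h
  unfold desc at hd
  obtain ⟨a, ha⟩ : ∃ a, a = v⁻¹ (lo k) := ⟨_, rfl⟩
  obtain ⟨b, hb⟩ : ∃ b, b = v⁻¹ (k + 1) := ⟨_, rfl⟩
  rw [← ha, ← hb] at hd
  have ha' : v a = lo k := by rw [ha]; simp
  have hb' : v b = k + 1 := by rw [hb]; simp
  have hma : v (-a) = - lo k := by rw [h.1, ha']
  have hmb : v (-b) = -(k + 1) := by rw [h.1, hb']
  have ha0 : a ≠ 0 := by rintro rfl; rw [h.zero] at ha'; exact lo_ne k ha'.symm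
  have hb0 : b ≠ 0 := by rintro rfl; rw [h.zero] at hb'; exact hi_ne k hb'.symm
  have hinj : ∀ {x y z}, v x = z → v y = z → x = y := fun h1 h2 => v.injective (h1.trans h2.symm)
  obtain ⟨e, he⟩ : ∃ e : ℤ × ℤ, e = if -a ≤ b then (b, a) else (-a, -b) := ⟨_, rfl⟩
  have hlo := lo_lt k
  have s1 : s k (lo k) = k + 1 := by rw [s_apply]; simp
  have s2 : s k (k + 1) = lo k := s_hi k
  have s3 : s k (-lo k) = -(k + 1) := by rw [(Bn_s hk).1, s1]
  have s4 : s k (-(k + 1)) = -lo k := by rw [(Bn_s hk).1, s2]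
  have key : Inv v = insert e (Inv (s k * v)) := by
    ext ⟨i, j⟩
    simp only [Inv, Set.mem_ofPred_eq, Set.mem_insert_iff, Perm.mul_apply]
    constructor
    · rintro ⟨h1, h2, h3, h4⟩
      by_cases hc : s k (v j) < s k (v i)
      · right; exact ⟨h1, h2, h3, hc⟩
      · left
        have hne : s k (v j) ≠ s k (v i) := by
          intro hh
          have := v.injective ((s k).injective hh)
          omega
        rcases s_flip k (h.ne (by omega)) (h.ne h1) h4 (by omega) with ⟨h5, h6⟩ | ⟨h5, h6⟩
        · have e1 := hinj h5 ha'
          have e2 := hinj h6 hb'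
          subst e1 e2
          rw [he, if_pos h2]
        · have e1 := hinj h5 hmb
          have e2 := hinj h6 hma
          rw [he]
          split_ifs with hh
          · have : a = -b := by omega
            ext <;> simp <;> omega
          · ext <;> simp <;> omega
    · rintro (h0 | ⟨h1, h2, h3, h4⟩)
      · rw [he] at h0
        split_ifs at h0 with hh
        · simp only [Prod.mk.injEq] at h0
          obtain ⟨rfl, rfl⟩ := h0
          refine ⟨hb0, hh, hd, ?_⟩
          rw [ha', hb']; exact hlo
        · simp only [Prod.mk.injEq] at h0
          obtain ⟨rfl, rfl⟩ := h0
          refine ⟨by omega, by omega, by omega, ?_⟩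
          rw [hma, hmb]; omega
      · refine ⟨h1, h2, h3, ?_⟩
        by_contra hc
        have hne : v j ≠ v i := by
          intro hh
          have := v.injective hh
          omega
        rcases s_flip k (h.ne h1) (h.ne (by omega)) (show v i < v j by omega) h4 with ⟨h5, h6⟩ | ⟨h5, h6⟩
        · have e1 := hinj h5 ha'
          have e2 := hinj h6 hb'
          omega
        · have e1 := hinj h5 hmb
          have e2 := hinj h6 hma
          omega
  have hnot : e ∉ Inv (s k * v) := by
    rw [he]
    simp only [Inv, Set.mem_ofPred_eq, Perm.mul_apply]
    split_ifs with hh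
    · simp only [ha', hb', s1, s2]; omega
    · simp only [hma, hmb, s3, s4]; omega
  rw [ell, key, Set.ncard_insert_of_notMem hnot (Inv_finite hB), ell]

lemma desc_s {k : ℕ} {v : Perm ℤ} (hd : ¬ desc k v) : desc k (s k * v) := by
  have s1 : s k (lo k) = k + 1 := by rw [s_apply]; simp
  have s2 : s k (k + 1) = lo k := s_hi k
  unfold desc at *
  simp only [mul_inv_rev, s_inv, Perm.mul_apply, s1, s2]
  have : v⁻¹ (lo k) ≠ v⁻¹ (k + 1) := by
    intro h; have := v⁻¹.injective h; have := lo_lt k; omega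
  omega

lemma ell_asc {K k : ℕ} {v : Perm ℤ} (h : Bn K v) (hk : k < K) (hd : ¬ desc k v) :
    ell (s k * v) = ell v + 1 := by
  have := ell_desc ((Bn_s hk).mul h) hk (desc_s hd)
  rwa [s_mul_s_mul] at this

lemma desc_iff {K k : ℕ} {v : Perm ℤ} (h : Bn K v) (hk : k < K) :
    desc k v ↔ ell (s k * v) < ell v := by
  by_cases hd : desc k v
  · have := ell_desc h hk hd; simp [hd]; omega
  · have := ell_asc h hk hd; simp [hd]; omega

lemma not_desc_of_le {K k : ℕ} {v : Perm ℤ} (h : Bn K v) (hk : K ≤ k) : ¬ desc k v := by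
  unfold desc
  rw [h.inv.2 (k + 1) (by omega)]
  intro hc
  by_cases h0 : K = k
  · subst h0
    have : |lo K| ≤ K + 1 := by rw [abs_le]; unfold lo; split_ifs <;> omega
    have := (h.mono (Nat.le_succ K)).inv.range (i := lo K) (by push_cast; exact this)
    rw [abs_le] at this
    push_cast at this
    omega
  · have : lo k = k := by unfold lo; split_ifs <;> omega
    rw [this, h.inv.2 k (by omega)] at hc
    omega

lemma exists_desc {K : ℕ} {v : Perm ℤ} (h : Bn K v) (hv : v ≠ 1) : ∃ k, k < K ∧ desc k v := by
  by_contra! hc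
  apply hv
  have hnd : ∀ k, ¬ desc k v := fun k => by
    by_cases hk : k < K
    · exact hc k hk
    · exact not_desc_of_le h (by omega)
  have hi := h.inv
  have hlt : ∀ k : ℕ, v⁻¹ (lo k) < v⁻¹ (k + 1) := fun k => by
    have := hnd k
    unfold desc at this
    have h2 : v⁻¹ (lo k) ≠ v⁻¹ (k + 1) := by
      intro h; have := v⁻¹.injective h; have := lo_lt k; omega
    omega
  have hpos : ∀ k : ℕ, v⁻¹ k < v⁻¹ (k + 1) := fun k => by
    have := hlt k
    unfold lo at this
    split_ifs at this with h0
    · subst h0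
      rw [hi.1] at this
      simp only [Nat.cast_zero, zero_add] at *
      rw [hi.zero]; omega
    · exact this
  have hmono : StrictMono (v⁻¹ : Perm ℤ) := by
    apply strictMono_int_of_lt_succ
    intro n
    rcases Int.lt_or_le n 0 with hn | hn
    · have := hpos (-n-1).toNat
      rw [Int.toNat_of_nonneg (by omega)] at this
      have e1 : -n - 1 = -(n+1) := by ring
      have e2 : -n - 1 + 1 = -n := by ring
      rw [e2, e1, hi.1, hi.1] at this
      omega
    · have := hpos n.toNat
      rwa [Int.toNat_of_nonneg hn] at this
  have hge : ∀ k : ℕ, v⁻¹ (k : ℤ) = k := by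
    intro k
    induction k with
    | zero => simpa using hi.zero
    | succ k ih =>
      have h1 := hpos k
      rw [ih] at h1
      by_contra hne
      push_cast at hne
      have h2 : v⁻¹ k < v⁻¹ (v (k + 1)) := by simp [ih]
      have h3 : v⁻¹ (v (k+1)) < v⁻¹ (k + 1) := by rw [inv_app]; omega
      have h4 := hmono.lt_iff_lt.1 h2
      have h5 := hmono.lt_iff_lt.1 h3
      omega
  have : v⁻¹ = 1 := by
    ext x
    rcases Int.lt_or_le x 0 with hx | hx
    · have := hge (-x).toNat
      rw [Int.toNat_of_nonneg (by omega), hi.1] at this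
      rw [Perm.one_apply]; omega
    · have := hge x.toNat
      rw [Int.toNat_of_nonneg hx] at this
      exact this
  simpa using this

lemma ell_one : ell 1 = 0 := by
  have : Inv 1 = ∅ := by
    ext ⟨i, j⟩
    simp [Inv]
    intros; omega
  rw [ell, this, Set.ncard_empty]

lemma eq_one_of_ell {K : ℕ} {v : Perm ℤ} (h : Bn K v) (h0 : ell v = 0) : v = 1 := by
  by_contra hv
  obtain ⟨k, hk, hd⟩ := exists_desc h hv
  have := ell_desc h hk hd
  omega

lemma ell_mul_T_lt {K : ℕ} {a b : ℤ} (ha : a ≠ 0) (hb : b ≠ 0) (h1 : |a| ≤ K) (h2 : |b| ≤ K)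
    (hab : a < b) : ∀ d, ∀ v, Bn K v → ell v = d → v b < v a → ell (v * T a b) < ell v := by
  intro d
  induction d using Nat.strong_induction_on with
  | _ d ih =>
    intro v h hd hv
    have hne : v ≠ 1 := by rintro rfl; simp at hv; omega
    obtain ⟨k, hk, hdk⟩ := exists_desc h hne
    have e1 := ell_desc h hk hdk
    have hB := (Bn_s hk).mul h
    by_cases hc : s k (v b) < s k (v a)
    · have e2 := ih (ell (s k * v)) (by omega) (s k * v) hB rfl hc
      have hB2 : Bn K (v * T a b) := h.mul (Bn_T ha hb h1 h2)
      rw [mul_assoc] at e2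
      by_cases hd2 : desc k (v * T a b)
      · have := ell_desc hB2 hk hd2; omega
      · have := ell_asc hB2 hk hd2; omega
    · have hne : s k (v b) ≠ s k (v a) := by
        intro hh
        have := v.injective ((s k).injective hh)
        omega
      have := s_flip_T k (h.ne hb) (h.ne ha) hv (by omega)
      rw [conj h, T_comm, this]
      omega

lemma ell_lt_mul_T {K : ℕ} {a b : ℤ} {v : Perm ℤ} (ha : a ≠ 0) (hb : b ≠ 0) (h1 : |a| ≤ K)
    (h2 : |b| ≤ K) (hab : a < b) (h : Bn K v) (hv : v a < v b) : ell v < ell (v * T a b) := by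
  have := ell_mul_T_lt ha hb h1 h2 hab _ (v * T a b) (h.mul (Bn_T ha hb h1 h2)) rfl ?_
  · rwa [mul_T_T ha hb] at this
  · simp only [Perm.mul_apply, T_apply ha hb]
    grind

lemma lt_iff_ell {K : ℕ} {a b : ℤ} {v : Perm ℤ} (ha : a ≠ 0) (hb : b ≠ 0) (h1 : |a| ≤ K)
    (h2 : |b| ≤ K) (hab : a < b) (h : Bn K v) : ell v < ell (v * T a b) ↔ v a < v b := by
  constructor
  · intro h3
    by_contra hc
    have hne : v a ≠ v b := by
      intro hh; have := v.injective hh; omega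
    have := ell_mul_T_lt ha hb h1 h2 hab _ v h rfl (by omega)
    omega
  · exact ell_lt_mul_T ha hb h1 h2 hab h

end BW

namespace BW

open Equiv


open Classical in
/-- number of reduced words of length `d` (letters `< M`) -/
noncomputable def cnt (M : ℕ) : ℕ → Perm ℤ → ℕ
  | 0, v => if v = 1 then 1 else 0
  | d + 1, v => ∑ k ∈ Finset.range M, if desc k v then cnt M d (s k * v) else 0

/-- number of reduced words -/
noncomputable def N (M : ℕ) (v : Perm ℤ) : ℕ := cnt M (ell v) v

open Classical in
lemma N_rec {M : ℕ} {v : Perm ℤ} (h : Bn M v) (hv : v ≠ 1) :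
    N M v = ∑ k ∈ Finset.range M, if desc k v then N M (s k * v) else 0 := by
  obtain ⟨e, he⟩ : ∃ e, ell v = e + 1 := by
    rcases Nat.eq_zero_or_pos (ell v) with h0 | h0
    · exact absurd (eq_one_of_ell h h0) hv
    · exact ⟨ell v - 1, by omega⟩
  rw [N, he, cnt]
  apply Finset.sum_congr rfl
  intro k hk
  rw [Finset.mem_range] at hk
  split_ifs with hd
  · have := ell_desc h hk hd
    rw [N]
    congr 1
    omega
  · rfl

lemma N_one (M : ℕ) : N M 1 = 1 := by
  rw [N, ell_one, cnt]; simp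

lemma N_pos {M : ℕ} : ∀ d, ∀ v : Perm ℤ, Bn M v → ell v = d → 0 < N M v := by
  classical
  intro d
  induction d using Nat.strong_induction_on with
  | _ d ih =>
    intro v h hd
    by_cases hv : v = 1
    · subst hv; rw [N_one]; omega
    · rw [N_rec h hv]
      obtain ⟨k, hk, hdk⟩ := exists_desc h hv
      have e := ell_desc h hk hdk
      apply Finset.sum_pos'
      · intros; omega
      · refine ⟨k, Finset.mem_range.2 hk, ?_⟩
        rw [if_pos hdk]
        exact ih _ (by omega) _ ((Bn_s hk).mul h) rfl

lemma nonflip {M k : ℕ} {v : Perm ℤ} (h : Bn M v) (hk : k < M) {a b : ℤ} (ha : a ≠ 0) (hb : b ≠ 0)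
    (hab : a ≠ b) (h1 : |a| ≤ M) (h2 : |b| ≤ M) (hne : v * T a b ≠ s k * v) :
    ell v < ell (v * T a b) ↔ ell (s k * v) < ell (s k * (v * T a b)) := by
  wlog hlt : a < b generalizing a b
  · have := this hb ha hab.symm h2 h1 (by rwa [T_comm]) (by omega)
    rwa [T_comm] at this
  rw [← mul_assoc, lt_iff_ell ha hb h1 h2 hlt h, lt_iff_ell ha hb h1 h2 hlt ((Bn_s hk).mul h)]
  rw [conj h] at hne
  simp only [Perm.mul_apply]
  have hv : v a ≠ v b := fun hh => hab (v.injective hh)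
  have hsv : s k (v a) ≠ s k (v b) := fun hh => hv ((s k).injective hh)
  constructor
  · intro hl
    by_contra hc
    exact hne (by rw [s_flip_T k (h.ne ha) (h.ne hb) hl (by omega)])
  · intro hl
    by_contra hc
    exact hne (by rw [T_comm, s_flip_T k (h.ne hb) (h.ne ha) (by omega) hl])

/-- index set of transition sums -/
noncomputable def Q (K : ℕ) (r : ℤ) : Finset ℤ := (Finset.Icc (-((K : ℤ) + 1)) (K + 1)).filter (fun q => q ≠ 0 ∧ q ≠ r)

/-- sign of the transition term -/
def eps (r q : ℤ) : ℤ := if q < r then 1 else -1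

/-- transition term -/
noncomputable def term (M : ℕ) (r : ℤ) (v : Perm ℤ) (q : ℤ) : ℤ :=
  if ell (v * T r q) = ell v + 1 then (N M (v * T r q) : ℤ) else 0

open Classical in
lemma term_step {K k : ℕ} {v : Perm ℤ} {r q : ℤ} (h : Bn (K+1) v) (hk : k < K + 1)
    (hr : r ≠ 0) (hq : q ≠ 0) (hrq : r ≠ q) (h1 : |r| ≤ K + 1) (h2 : |q| ≤ K + 1) :
    (if ell (v * T r q) = ell v + 1 ∧ desc k (v * T r q) then (N (K+1) (s k * (v * T r q)) : ℤ)
      else 0) = (if desc k v then term (K+1) r (s k * v) q else 0) +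
      (if v * T r q = s k * v then (if desc k v then -1 else 1) * (N (K+1) v : ℤ) else 0) := by
  have hT : Bn (K+1) (v * T r q) := h.mul (Bn_T hr hq (by exact_mod_cast h1) (by exact_mod_cast h2))
  by_cases heq : v * T r q = s k * v
  · rw [if_pos heq, term, mul_assoc, heq, s_mul_s_mul]
    by_cases hd : desc k v
    · have e := ell_desc h hk hd
      rw [if_neg (by omega), if_pos hd, if_pos (by omega), if_pos hd]; ring
    · have e := ell_asc h hk hd
      rw [if_pos ⟨e, desc_s hd⟩, if_neg hd, if_neg hd]; ring
  · rw [if_neg heq, add_zero, term, mul_assoc]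
    have nf := nonflip h hk hr hq hrq (by exact_mod_cast h1) (by exact_mod_cast h2) heq
    by_cases hd : desc k v
    · have e := ell_desc h hk hd
      by_cases hd2 : desc k (v * T r q)
      · have e2 := ell_desc hT hk hd2
        simp only [hd, hd2, and_true, if_true]
        congr 1
        simp only [eq_iff_iff]; omega
      · have e2 := ell_asc hT hk hd2
        simp only [hd, hd2, and_false, if_true, if_false]
        rw [if_neg (by omega)]
    · have e := ell_asc h hk hd
      by_cases hd2 : desc k (v * T r q)
      · have e2 := ell_desc hT hk hd2
        simp only [hd, hd2, and_true, if_false]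
        rw [if_neg (by omega)]
      · simp [hd, hd2]

/-- next nonzero integer -/
def up (m : ℤ) : ℤ := if m = -1 then 1 else m + 1
/-- previous nonzero integer -/
def dn (m : ℤ) : ℤ := if m = 1 then -1 else m - 1
/-- letter exchanging `m` and `up m` -/
def ku (m : ℤ) : ℕ := (if 0 < m then m else -m - 1).toNat
/-- letter exchanging `m` and `dn m` -/
def kd (m : ℤ) : ℕ := (if 0 < m then m - 1 else -m).toNat

lemma ku_pos {m : ℤ} (hm : 0 < m ∨ m = -1) : lo (ku m) = m ∧ ((ku m : ℕ) : ℤ) + 1 = up m := by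
  rcases hm with hm | rfl
  · have e : ((ku m : ℕ) : ℤ) = m := by unfold ku; rw [if_pos hm]; omega
    unfold lo up
    constructor
    · rw [if_neg (by omega), e]
    · rw [if_neg (by omega), e]
  · constructor <;> rfl

lemma ku_neg {m : ℤ} (hm : m < -1) : lo (ku m) = - up m ∧ ((ku m : ℕ) : ℤ) + 1 = - m := by
  have e : ((ku m : ℕ) : ℤ) = - m - 1 := by unfold ku; rw [if_neg (by omega)]; omega
  unfold lo up
  constructor
  · rw [if_neg (by omega), if_neg (by omega)]; omega
  · omega

lemma kd_pos {m : ℤ} (hm : 0 < m) : lo (kd m) = dn m ∧ ((kd m : ℕ) : ℤ) + 1 = m := by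
  have e : ((kd m : ℕ) : ℤ) = m - 1 := by unfold kd; rw [if_pos hm]; omega
  unfold lo dn
  constructor
  · split_ifs <;> omega
  · omega

lemma kd_neg {m : ℤ} (hm : m < 0) : lo (kd m) = - m ∧ ((kd m : ℕ) : ℤ) + 1 = - dn m := by
  have e : ((kd m : ℕ) : ℤ) = - m := by unfold kd; rw [if_neg (by omega)]; omega
  unfold lo dn
  constructor
  · split_ifs <;> omega
  · split_ifs <;> omega

lemma T_eq_s {m y : ℤ} {k : ℕ} (hm : m ≠ 0) (hy : y ≠ 0) (hmy : y ≠ m) :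
    T m y = s k ↔ (y = up m ∧ k = ku m) ∨ (y = dn m ∧ k = kd m) := by
  constructor
  · intro h
    have h1 : s k m = y := by rw [← h, T_apply hm hy]; simp
    rw [s_apply] at h1
    have hlo : lo k = -1 ∧ k = 0 ∨ lo k = k ∧ k ≠ 0 := by unfold lo; split_ifs <;> omega
    unfold up dn ku kd
    by_cases c1 : m = lo k
    · rw [if_pos c1] at h1; left
      constructor <;> split_ifs <;> omega
    rw [if_neg c1] at h1
    by_cases c2 : m = k + 1
    · rw [if_pos c2] at h1; right
      constructor <;> split_ifs <;> omega
    rw [if_neg c2] at h1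
    by_cases c3 : m = - lo k
    · rw [if_pos c3] at h1; right
      constructor <;> split_ifs <;> omega
    rw [if_neg c3] at h1
    by_cases c4 : m = -(k + 1)
    · rw [if_pos c4] at h1; left
      constructor <;> split_ifs <;> omega
    rw [if_neg c4] at h1
    omega
  · rintro (⟨rfl, rfl⟩ | ⟨rfl, rfl⟩)
    · unfold s
      by_cases hp : 0 < m ∨ m = -1
      · rw [(ku_pos hp).1, (ku_pos hp).2]
      · rw [(ku_neg (by omega)).1, (ku_neg (by omega)).2, T_neg hy hm, T_comm]
    · unfold s
      by_cases hp : 0 < m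
      · rw [(kd_pos hp).1, (kd_pos hp).2, T_comm]
      · rw [(kd_neg (by omega)).1, (kd_neg (by omega)).2, T_neg hm hy]

lemma desc_up {K : ℕ} {v : Perm ℤ} (h : Bn K v) {r q : ℤ} (hr : r ≠ 0) (hq : v q = up (v r)) :
    desc (ku (v r)) v ↔ q < r := by
  have hm := h.ne hr
  have e1 : v⁻¹ (v r) = r := inv_app v r
  have e2 : v⁻¹ (up (v r)) = q := by rw [← hq, inv_app]
  unfold desc
  by_cases hp : 0 < v r ∨ v r = -1
  · rw [(ku_pos hp).1, (ku_pos hp).2, e1, e2]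
  · rw [(ku_neg (by omega)).1, (ku_neg (by omega)).2, h.inv.1, h.inv.1, e1, e2]; omega

lemma desc_dn {K : ℕ} {v : Perm ℤ} (h : Bn K v) {r q : ℤ} (hr : r ≠ 0) (hq : v q = dn (v r)) :
    desc (kd (v r)) v ↔ r < q := by
  have hm := h.ne hr
  have e1 : v⁻¹ (v r) = r := inv_app v r
  have e2 : v⁻¹ (dn (v r)) = q := by rw [← hq, inv_app]
  unfold desc
  by_cases hp : 0 < v r
  · rw [(kd_pos hp).1, (kd_pos hp).2, e1, e2]
  · rw [(kd_neg (by omega)).1, (kd_neg (by omega)).2, h.inv.1, h.inv.1, e1, e2]; omega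

open Classical in
lemma boundary {K : ℕ} {v : Perm ℤ} (h : Bn K v) {r : ℤ} (hr : 1 ≤ r) (hrK : r ≤ K) :
    ∑ q ∈ Q K r, ∑ k ∈ Finset.range (K + 1),
      eps r q * (if v * T r q = s k * v then (if desc k v then -1 else 1) else 0) = 0 := by
  have hr0 : r ≠ 0 := by omega
  have hm0 := h.ne hr0
  have hmK := h.range (i := r) (by rw [abs_le]; omega)
  rw [abs_le] at hmK
  obtain ⟨qu, hqu⟩ : ∃ q, v q = up (v r) := ⟨v⁻¹ (up (v r)), app_inv _ _⟩
  obtain ⟨qd, hqd⟩ : ∃ q, v q = dn (v r) := ⟨v⁻¹ (dn (v r)), app_inv _ _⟩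
  have hmem : ∀ q, (v q = up (v r) ∨ v q = dn (v r)) → q ∈ Q K r := by
    intro q hq
    have b1 : |v q| ≤ ((K + 1 : ℕ) : ℤ) := by
      rw [abs_le]; unfold up dn at hq; push_cast; grind
    have b2 := (h.mono (Nat.le_succ K)).inv.range b1
    rw [inv_app, abs_le] at b2
    simp only [Q, Finset.mem_filter, Finset.mem_Icc]
    push_cast at b2
    refine ⟨⟨by omega, by omega⟩, ?_, ?_⟩
    · rintro rfl
      rw [h.zero] at hq
      unfold up dn at hq; grind
    · rintro rfl
      unfold up dn at hq; grind
  have hku : ku (v r) < K + 1 := by unfold ku; grind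
  have hkd : kd (v r) < K + 1 := by unfold kd; grind
  have hud : up (v r) ≠ dn (v r) := by unfold up dn; grind
  have key : ∀ q ∈ Q K r, ∀ k ∈ Finset.range (K + 1),
      eps r q * (if v * T r q = s k * v then (if desc k v then -1 else 1) else 0) =
      (if q = qu then (if k = ku (v r) then -1 else 0) else 0) +
      (if q = qd then (if k = kd (v r) then 1 else 0) else 0) := by
    intro q hq k _
    simp only [Q, Finset.mem_filter, Finset.mem_Icc] at hq
    have hvq : v q ≠ v r := fun hh => hq.2.2 (v.injective hh)
    have c1 : v * T r q = s k * v ↔ (q = qu ∧ k = ku (v r)) ∨ (q = qd ∧ k = kd (v r)) := by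
      rw [conj h, mul_left_inj, T_eq_s hm0 (h.ne hq.2.1) hvq, ← hqu, ← hqd, v.injective.eq_iff,
        v.injective.eq_iff]
    by_cases c2 : q = qu ∧ k = ku (v r)
    · rw [if_pos (c1.2 (Or.inl c2))]
      obtain ⟨rfl, rfl⟩ := c2
      have : q ≠ qd := by rintro rfl; exact hud (hqu.symm.trans hqd)
      rw [if_pos rfl, if_pos rfl, if_neg this, eps]
      have := desc_up h hr0 hqu
      by_cases hlt : q < r
      · rw [if_pos hlt, if_pos (this.2 hlt)]; norm_num
      · rw [if_neg hlt, if_neg (fun hh => hlt (this.1 hh))]; norm_num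
    · by_cases c3 : q = qd ∧ k = kd (v r)
      · rw [if_pos (c1.2 (Or.inr c3))]
        obtain ⟨rfl, rfl⟩ := c3
        have : q ≠ qu := by rintro rfl; exact hud (hqu.symm.trans hqd)
        rw [if_neg this, if_pos rfl, if_pos rfl, eps]
        have := desc_dn h hr0 hqd
        by_cases hlt : q < r
        · rw [if_pos hlt, if_neg (fun hh => by have := this.1 hh; omega)]; norm_num
        · rw [if_neg hlt, if_pos (this.2 (by omega))]; norm_num
      · rw [if_neg (fun hh => (c1.1 hh).elim c2 c3)]
        grind
  rw [Finset.sum_congr rfl (fun q hq => Finset.sum_congr rfl (key q hq))]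
  simp only [Finset.sum_add_distrib]
  have e1 : ∑ q ∈ Q K r, ∑ k ∈ Finset.range (K + 1),
      (if q = qu then (if k = ku (v r) then (-1 : ℤ) else 0) else 0) = -1 := by
    rw [Finset.sum_eq_single qu]
    · rw [Finset.sum_eq_single (ku (v r))] <;> simp +contextual [hku]
    · intro b _ hb; simp [hb]
    · intro hh; exact absurd (hmem qu (Or.inl hqu)) hh
  have e2 : ∑ q ∈ Q K r, ∑ k ∈ Finset.range (K + 1),
      (if q = qd then (if k = kd (v r) then (1 : ℤ) else 0) else 0) = 1 := by
    rw [Finset.sum_eq_single qd]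
    · rw [Finset.sum_eq_single (kd (v r))] <;> simp +contextual [hkd]
    · intro b _ hb; simp [hb]
    · intro hh; exact absurd (hmem qd (Or.inr hqd)) hh
  rw [e1, e2]; norm_num

/-- the transition identity -/
theorem transition {K : ℕ} {r : ℤ} (hr : 1 ≤ r) (hrK : r ≤ K) : ∀ d, ∀ v : Perm ℤ, Bn K v →
    ell v = d → ∑ q ∈ Q K r, eps r q * term (K + 1) r v q = 0 := by
  classical
  intro d
  induction d using Nat.strong_induction_on with
  | _ d ih =>
    intro v h hd
    have h' := h.mono (Nat.le_succ K)
    have hr0 : r ≠ 0 := by omega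
    have step : ∀ q ∈ Q K r, eps r q * term (K+1) r v q =
        ∑ k ∈ Finset.range (K+1), (if desc k v then eps r q * term (K+1) r (s k * v) q else 0) +
        ∑ k ∈ Finset.range (K+1), (eps r q *
          (if v * T r q = s k * v then (if desc k v then -1 else 1) else 0)) * (N (K+1) v : ℤ) := by
      intro q hq
      simp only [Q, Finset.mem_filter, Finset.mem_Icc] at hq
      have e : term (K+1) r v q = ∑ k ∈ Finset.range (K+1),
          (if ell (v * T r q) = ell v + 1 ∧ desc k (v * T r q)
            then (N (K+1) (s k * (v * T r q)) : ℤ) else 0) := by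
        unfold term
        by_cases hc : ell (v * T r q) = ell v + 1
        · rw [if_pos hc, N_rec (h'.mul (Bn_T hr0 hq.2.1 ?_ ?_)) ?_]
          · push_cast
            apply Finset.sum_congr rfl
            intro k _
            simp [hc]
          · rw [abs_le]; push_cast; omega
          · rw [abs_le]; push_cast; omega
          · intro h1; rw [h1, ell_one] at hc; omega
        · simp [hc]
      rw [e, ← Finset.sum_add_distrib, Finset.mul_sum]
      apply Finset.sum_congr rfl
      intro k hk
      rw [term_step h' (Finset.mem_range.1 hk) hr0 hq.2.1 (Ne.symm hq.2.2)
        (by rw [abs_le]; omega) (by rw [abs_le]; omega)]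
      split_ifs <;> ring
    rw [Finset.sum_congr rfl step, Finset.sum_add_distrib]
    have z1 : ∑ q ∈ Q K r, ∑ k ∈ Finset.range (K+1), (if desc k v then
        eps r q * term (K+1) r (s k * v) q else 0) = 0 := by
      rw [Finset.sum_comm]
      apply Finset.sum_eq_zero
      intro k _
      by_cases hdk : desc k v
      · simp only [hdk, if_true]
        have hk : k < K := by
          by_contra hc
          exact not_desc_of_le h (by omega) hdk
        have := ell_desc h hk hdk
        exact ih _ (by omega) _ ((Bn_s hk).mul h) rfl
      · simp [hdk]
    have z2 := boundary h hr hrK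
    rw [z1, zero_add]
    simp only [← Finset.sum_mul]
    rw [z2, zero_mul]

end BW

namespace BW

open Equiv

lemma noncover_A {M : ℕ} {v : Perm ℤ} (h : Bn M v) {q p r : ℤ} (hq : q ≠ 0) (hp : p ≠ 0)
    (hr : r ≠ 0) (hqM : |q| ≤ M) (hpM : |p| ≤ M) (hrM : |r| ≤ M) (h1 : q < p) (h2 : p < r)
    (n1 : q ≠ -p) (n2 : p ≠ -r) (n3 : q ≠ -r) (v1 : v q < v p) (v2 : v p < v r) :
    ell (v * T q r) ≠ ell v + 1 := by
  have e : v * T q r = v * T q p * T p r * T q p := by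
    rw [mul_assoc, mul_assoc]
    congr 1
    ext x
    simp only [Perm.mul_apply, T_apply hq hr, T_apply hq hp, T_apply hp hr]
    by_cases c1 : x = q
    · subst c1; grind
    by_cases c2 : x = p
    · subst c2; grind
    by_cases c3 : x = r
    · subst c3; grind
    by_cases c4 : x = -q
    · subst c4; grind
    by_cases c5 : x = -p
    · subst c5; grind
    by_cases c6 : x = -r
    · subst c6; grind
    simp [c1, c2, c3, c4, c5, c6]
  have b1 := Bn_T hq hp hqM hpM
  have b2 := Bn_T hp hr hpM hrM
  have i1 := ell_lt_mul_T hq hp hqM hpM h1 h v1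
  have i2 := ell_lt_mul_T hp hr hpM hrM h2 (h.mul b1) (by
    simp only [Perm.mul_apply, T_apply hq hp]
    have a1 : p ≠ q := by omega
    have a2 : r ≠ q := by omega
    have a3 : r ≠ p := by omega
    have a4 : r ≠ -q := by omega
    have a5 : r ≠ -p := by omega
    simp only [a1, a2, a3, a4, a5, if_true, if_false]
    omega)
  have i3 := ell_lt_mul_T hq hp hqM hpM h1 ((h.mul b1).mul b2) (by
    simp only [Perm.mul_apply, T_apply hq hp, T_apply hp hr]
    have a1 : q ≠ p := by omega
    have a2 : q ≠ r := by omega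
    have a3 : q ≠ -p := by omega
    have a2 : r ≠ q := by omega
    have a3 : r ≠ p := by omega
    have a4 : r ≠ -q := by omega
    have a5 : r ≠ -p := by omega
    have a6 : q ≠ r := by omega
    simp only [*, if_true, if_false, ne_eq])
  rw [e]; omega

lemma noncover_Z' {M : ℕ} {v : Perm ℤ} (h : Bn M v) {i r : ℤ} (hi : 0 < i) (hir : i < r)
    (hrM : r ≤ M) (v1 : 0 < v i) (v2 : 0 < v r) :
    ell (v * T r (-i)) ≠ ell v + 1 := by
  have hi0 : i ≠ 0 := by omega
  have hi0' : -i ≠ 0 := by omega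
  have hr0 : r ≠ 0 := by omega
  have e : v * T r (-i) = v * T (-i) i * T i r * T (-i) i := by
    rw [mul_assoc, mul_assoc]
    congr 1
    ext x
    simp only [Perm.mul_apply, T_apply hi0' hi0, T_apply hi0 hr0, T_apply hr0 hi0']
    by_cases c1 : x = i
    · subst c1; grind
    by_cases c3 : x = r
    · subst c3; grind
    by_cases c4 : x = -i
    · subst c4; grind
    by_cases c6 : x = -r
    · subst c6; grind
    simp [c1, c3, c4, c6]
  have m1 : |-i| ≤ (M : ℤ) := by rw [abs_le]; omega
  have m2 : |i| ≤ (M : ℤ) := by rw [abs_le]; omega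
  have m3 : |r| ≤ (M : ℤ) := by rw [abs_le]; omega
  have b1 := Bn_T hi0' hi0 m1 m2
  have b2 := Bn_T hi0 hr0 m2 m3
  have i1 := ell_lt_mul_T hi0' hi0 m1 m2 (by omega) h (by rw [h.1]; omega)
  have a1 : i ≠ -i := by omega
  have a2 : r ≠ i := by omega
  have a3 : r ≠ -i := by omega
  have a4 : -i ≠ i := by omega
  have a5 : -i ≠ r := by omega
  have i2 := ell_lt_mul_T hi0 hr0 m2 m3 hir (h.mul b1) (by
    simp only [Perm.mul_apply, T_apply hi0' hi0, neg_neg]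
    simp only [a1, a2, a3, if_true, if_false, h.1]
    omega)
  have i3 := ell_lt_mul_T hi0' hi0 m1 m2 (by omega) ((h.mul b1).mul b2) (by
    rw [((h.mul b1).mul b2).1]
    simp only [Perm.mul_apply, T_apply hi0 hr0, T_apply hi0' hi0, neg_neg]
    simp only [a2, a3, if_true, if_false]
    omega)
  rw [e]; omega

lemma noncover_Z {M : ℕ} {v : Perm ℤ} (h : Bn M v) {i r : ℤ} (hi : 0 < i) (hr : 0 < r)
    (hir : i ≠ r) (hiM : i ≤ M) (hrM : r ≤ M) (v1 : 0 < v i) (v2 : 0 < v r) :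
    ell (v * T r (-i)) ≠ ell v + 1 := by
  rcases lt_or_gt_of_ne hir with c | c
  · exact noncover_Z' h hi c hrM v1 v2
  · have := noncover_Z' h hr c hiM v2 v1
    rwa [T_comm, ← T_neg (by omega) (by omega), neg_neg, T_comm, T_comm] at this

lemma cover_flip {M : ℕ} {r : ℤ} (hr : 0 < r) (hrM : r ≤ M) : ∀ m : ℕ, ∀ v : Perm ℤ, Bn M v →
    v r = (m : ℤ) + 1 → (∀ x, 1 ≤ x → x < (m : ℤ) + 1 → r < v⁻¹ x) →
    ell (v * T r (-r)) = ell v + 1 := by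
  have hr0 : r ≠ 0 := by omega
  have hr0' : -r ≠ 0 := by omega
  have mr : |r| ≤ (M : ℤ) := by rw [abs_le]; omega
  have mr' : |-r| ≤ (M : ℤ) := by rw [abs_le]; omega
  intro m
  induction m with
  | zero =>
    intro v h hv _
    have hb := h.range mr
    rw [hv, abs_le] at hb
    have : v * T r (-r) = s 0 * v := by
      rw [conj h, h.1, hv, T_comm]; rfl
    rw [this]
    apply ell_asc h (by omega)
    unfold desc lo
    have e : v⁻¹ 1 = r := by
      rw [Perm.inv_eq_iff_eq, hv]; simp
    simp only [if_true, h.inv.1, Nat.cast_zero, zero_add, e]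
    omega
  | succ m ih =>
    intro v h hv hx
    have hb := h.range mr
    rw [hv, abs_le] at hb
    push_cast at hb hv hx
    have hk : m + 1 < M := by omega
    have hB := h.mul (Bn_T hr0 hr0' mr mr')
    have e : v⁻¹ ((m : ℤ) + 1 + 1) = r := by
      rw [Perm.inv_eq_iff_eq, hv]
    have hp := hx (m + 1) (by omega) (by omega)
    obtain ⟨p, hpe⟩ : ∃ p, p = v⁻¹ ((m : ℤ) + 1) := ⟨_, rfl⟩
    have hpv : v p = m + 1 := by rw [hpe, app_inv]
    rw [← hpe] at hp
    have hlo : lo (m + 1) = (m : ℤ) + 1 := by unfold lo; simp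
    have d1 : desc (m + 1) v := by
      unfold desc
      rw [hlo, ← hpe]; push_cast; rw [e]; exact hp
    have e2 : (v * T r (-r))⁻¹ ((m : ℤ) + 1 + 1) = -r := by
      rw [Perm.inv_eq_iff_eq, Perm.mul_apply, T_apply hr0 hr0']
      rw [if_neg (by omega), if_pos rfl, hv]
    have e3 : (v * T r (-r))⁻¹ ((m : ℤ) + 1) = p := by
      rw [Perm.inv_eq_iff_eq, Perm.mul_apply, T_apply hr0 hr0']
      rw [if_neg (by omega), if_neg (by omega), if_neg (by omega), if_neg (by omega), hpv]
    have d2 : desc (m + 1) (v * T r (-r)) := by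
      unfold desc
      rw [hlo, e3]; push_cast; rw [e2]; omega
    have l1 := ell_desc h hk d1
    have l2 := ell_desc hB hk d2
    have := ih (s (m + 1) * v) ((Bn_s hk).mul h) (by
      rw [Perm.mul_apply, hv, s_apply, hlo]
      push_cast
      rw [if_neg (by omega), if_pos rfl]) (by
      intro x hx1 hx2
      rw [mul_inv_rev, s_inv, Perm.mul_apply, s_apply, hlo]
      push_cast
      rw [if_neg (by omega), if_neg (by omega), if_neg (by omega), if_neg (by omega)]
      exact hx x hx1 (by omega))
    rw [mul_assoc] at this
    omega

lemma two_terms {K : ℕ} {r q1 q2 : ℤ} {v : Perm ℤ} (hr : 1 ≤ r) (hrK : r ≤ K) (h : Bn K v)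
    (h1 : r < q1) (h1' : q1 ≤ K + 1) (h2 : q2 < r) (h2' : -((K : ℤ) + 1) ≤ q2) (h2'' : q2 ≠ 0)
    (hz : ∀ q, q ≠ 0 → q ≠ q1 → q ≠ q2 → -((K : ℤ) + 1) ≤ q → q ≤ K + 1 →
      (r < q → v r < v q → ell (v * T r q) ≠ ell v + 1) ∧
      (q < r → v q < v r → ell (v * T r q) ≠ ell v + 1)) :
    term (K + 1) r v q1 = term (K + 1) r v q2 := by
  have ht := transition hr hrK _ v h rfl
  have h' := h.mono (Nat.le_succ K)
  have m1 : q1 ∈ Q K r := by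
    simp only [Q, Finset.mem_filter, Finset.mem_Icc]; omega
  have m2 : q2 ∈ (Q K r).erase q1 := by
    simp only [Q, Finset.mem_erase, Finset.mem_filter, Finset.mem_Icc]; omega
  rw [← Finset.add_sum_erase _ _ m1, ← Finset.add_sum_erase _ _ m2, Finset.sum_eq_zero] at ht
  · unfold eps at ht
    rw [if_neg (by omega), if_pos h2] at ht
    linarith
  · intro q hq
    simp only [Q, Finset.mem_erase, Finset.mem_filter, Finset.mem_Icc] at hq
    obtain ⟨hq2, hq1, ⟨hb1, hb2⟩, hq0, hqr⟩ := hq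
    obtain ⟨z1, z2⟩ := hz q hq0 hq1 hq2 hb1 hb2
    have : ell (v * T r q) ≠ ell v + 1 := by
      rcases lt_or_gt_of_ne hqr with c | c
      · by_cases hv : v q < v r
        · exact z2 c hv
        · have := lt_iff_ell hq0 (by omega) (by rw [abs_le]; push_cast; omega)
            (by rw [abs_le]; push_cast; omega) c h'
          rw [T_comm] at this
          intro he; apply hv; apply this.1; omega
      · by_cases hv : v r < v q
        · exact z1 c hv
        · have := lt_iff_ell (by omega) hq0 (by rw [abs_le]; push_cast; omega)
            (by rw [abs_le]; push_cast; omega) c h'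
          intro he; apply hv; apply this.1; omega
    unfold term
    rw [if_neg this, mul_zero]

/-- if one of the two surviving terms is a cover, so is the other, and the counts agree -/
lemma term_transfer {M : ℕ} {r q1 q2 : ℤ} {v : Perm ℤ} (hB : Bn M (v * T r q1))
    (h : term M r v q1 = term M r v q2)
    (hc : ell (v * T r q1) = ell v + 1) :
    ell (v * T r q2) = ell v + 1 ∧ N M (v * T r q2) = N M (v * T r q1) := by
  unfold term at h
  rw [if_pos hc] at h
  have := N_pos _ _ hB rfl
  by_cases c : ell (v * T r q2) = ell v + 1
  · rw [if_pos c] at h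
    exact ⟨c, by exact_mod_cast h.symm⟩
  · rw [if_neg c] at h
    omega

end BW

namespace BW

open Equiv

/-- longest element -/
def w0 (n : ℕ) : Perm ℤ where
  toFun x := if -(n : ℤ) ≤ x ∧ x ≤ n then -x else x
  invFun x := if -(n : ℤ) ≤ x ∧ x ≤ n then -x else x
  left_inv x := by dsimp only; split_ifs <;> omega
  right_inv x := by dsimp only; split_ifs <;> omega

lemma w0_apply (n : ℕ) (x : ℤ) : w0 n x = if -(n : ℤ) ≤ x ∧ x ≤ n then -x else x := rfl

lemma Bn_w0 (n : ℕ) : Bn n (w0 n) := by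
  constructor
  · intro i; rw [w0_apply, w0_apply]; split_ifs <;> omega
  · intro i hi; rw [w0_apply, if_neg (by omega)]

/-- values along the first chain -/
def Wf (n r : ℕ) (p : ℤ) : ℤ :=
  if p ≤ r then n + p else if p ≤ n then -p else if p ≤ n + r then p - n else p

lemma chain1 (n : ℕ) : ∀ r : ℕ, r ≤ n → ∃ w : Perm ℤ, Bn (2 * n) w ∧
    (∀ p, 0 < p → w p = Wf n r p) ∧ N (2 * n + 1) w = N (2 * n + 1) (w0 n) ∧
    ell w = ell (w0 n) := by
  intro r
  induction r with
  | zero =>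
    intro _
    refine ⟨w0 n, (Bn_w0 n).mono (by omega), ?_, rfl, rfl⟩
    intro p hp
    rw [w0_apply, Wf]
    split_ifs <;> push_cast at * <;> omega
  | succ r ih =>
    intro hr
    obtain ⟨w, hw, hwp, hN, hl⟩ := ih (by omega)
    obtain ⟨R, hR⟩ : ∃ R : ℤ, R = r + 1 := ⟨_, rfl⟩
    have hR0 : R ≠ 0 := by omega
    have hR0' : -R ≠ 0 := by omega
    have b1 : |R| ≤ ((2 * n : ℕ) : ℤ) := by rw [abs_le]; omega
    have b2 : |-R| ≤ ((2 * n : ℕ) : ℤ) := by rw [abs_le]; omega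
    obtain ⟨v, hv⟩ : ∃ v, v = w * T R (-R) := ⟨_, rfl⟩
    have hvw : v * T R (-R) = w := by rw [hv, mul_T_T hR0 hR0']
    have hvB : Bn (2 * n) v := by rw [hv]; exact hw.mul (Bn_T hR0 hR0' b1 b2)
    have hvR : v R = R := by
      rw [hv, Perm.mul_apply, T_apply hR0 hR0', if_pos rfl, hw.1, hwp R (by omega), Wf]
      rw [if_neg (by omega), if_pos (by omega)]; omega
    have hvp : ∀ p, 0 < p → p ≠ R → v p = Wf n r p := by
      intro p hp hpR
      rw [hv, Perm.mul_apply, T_apply hR0 hR0', if_neg hpR, if_neg (by omega), if_neg (by omega),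
        if_neg (by omega), hwp p hp]
    have hcov : ell (v * T R (-R)) = ell v + 1 := by
      apply cover_flip (by omega) (by push_cast; omega) r v hvB (by omega)
      intro x hx1 hx2
      have : v⁻¹ x = n + x := by
        rw [Perm.inv_eq_iff_eq, hvp _ (by omega) (by omega), Wf]
        rw [if_neg (by omega), if_neg (by omega), if_pos (by omega)]; omega
      rw [this]; omega
    have hvB' : Bn (2 * n + 1) v := hvB.mono (by omega)
    have ht : term (2 * n + 1) R v (n + R) = term (2 * n + 1) R v (-R) := by
      apply two_terms (by omega) (by push_cast; omega) hvB (by omega) (by push_cast; omega)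
        (by omega) (by push_cast; omega) (by omega)
      intro q hq0 hq1 hq2 hqb1 hqb2
      push_cast at hqb1 hqb2
      rw [hvR]
      constructor
      · intro c1 c2
        rw [hvp q (by omega) (by omega), Wf] at c2
        have c3 : n + R < q := by
          split_ifs at c2 <;> omega
        have e1 : v (n + R) = n + R := by
          rw [hvp _ (by omega) (by omega), Wf]
          rw [if_neg (by omega), if_neg (by omega), if_neg (by omega)]
        have e2 : v q = q := by
          rw [hvp _ (by omega) (by omega), Wf]
          rw [if_neg (by omega), if_neg (by omega), if_neg (by omega)]
        apply noncover_A hvB' (p := n + R) <;> first | omega | (rw [abs_le]; push_cast; omega)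
      · intro c1 c2
        have hq : q < 0 := by
          by_contra hc
          rw [hvp q (by omega) (by omega), Wf] at c2
          split_ifs at c2 <;> omega
        obtain ⟨i, rfl⟩ : ∃ i, q = -i := ⟨-q, by omega⟩
        have e := hvp i (by omega) (by omega)
        have : 0 < v i := by
          rw [hvB.1, e, Wf] at c2
          rw [e, Wf]
          split_ifs at c2 ⊢ <;> omega
        apply noncover_Z hvB' <;> first | omega | (push_cast; omega)
    have hB1 : Bn (2 * n) (v * T R (n + R)) :=
      hvB.mul (Bn_T hR0 (by omega) b1 (by rw [abs_le]; push_cast; omega))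
    obtain ⟨t1, t2⟩ := term_transfer (by rw [hvw]; exact hw.mono (by omega)) ht.symm hcov
    refine ⟨v * T R (n + R), hB1, ?_, ?_, ?_⟩
    · intro p hp
      rw [Perm.mul_apply, T_apply hR0 (by omega)]
      by_cases c1 : p = R
      · rw [if_pos c1, hvp _ (by omega) (by omega), Wf, Wf]
        push_cast
        split_ifs <;> omega
      by_cases c2 : p = n + R
      · rw [if_neg c1, if_pos c2, hvR, Wf]
        push_cast
        split_ifs <;> omega
      · rw [if_neg c1, if_neg c2, if_neg (by omega), if_neg (by omega), hvp _ hp c1, Wf, Wf]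
        push_cast
        split_ifs <;> omega
    · rw [t2, hvw, hN]
    · rw [t1, ← hcov, hvw, hl]

lemma chain2_step {K : ℕ} {w : Perm ℤ} (h : Bn K w) {a : ℕ} (ha : 1 ≤ a) {r t i0 : ℤ}
    (hr : 0 < r) (hrt : r < t) (htK : t ≤ K) (hi : 0 < i0) (hiK : i0 ≤ K) (wr : w r = -a)
    (wt : w t = -(a + 1)) (wi : w i0 = a + 2)
    (H1 : ∀ q, r < q → q < t → w q < -((a : ℤ) + 1))
    (H2 : ∀ q, 0 < q → q < r → -((a : ℤ) + 1) < w q)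
    (H3 : ∀ q, 0 < q → (a : ℤ) + 2 < w q → i0 < q) :
    Bn K (s (a + 1) * (s a * w)) ∧
    N (K + 1) (s (a + 1) * (s a * w)) = N (K + 1) w ∧ ell (s (a + 1) * (s a * w)) = ell w := by
  have hb := h.range (i := i0) (by rw [abs_le]; omega)
  rw [wi, abs_le] at hb
  have hlo : lo a = a := by unfold lo; rw [if_neg (by omega)]
  have hlo1 : lo (a + 1) = a + 1 := by unfold lo; rw [if_neg (by omega)]; push_cast; rfl
  obtain ⟨v, hv⟩ : ∃ v, v = s a * w := ⟨_, rfl⟩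
  have hvB : Bn K v := by rw [hv]; exact (Bn_s (by omega)).mul h
  have hvB' : Bn (K + 1) v := hvB.mono (by omega)
  have vr : v r = -(a + 1) := by
    rw [hv, Perm.mul_apply, wr, s_apply, hlo]
    rw [if_neg (by omega), if_neg (by omega), if_pos rfl]
  have vt : v t = -a := by
    rw [hv, Perm.mul_apply, wt, s_apply, hlo]
    rw [if_neg (by omega), if_neg (by omega), if_neg (by omega), if_pos rfl]
  have hvq : ∀ q, q ≠ r → q ≠ t → q ≠ -r → q ≠ -t → v q = w q := by
    intro q h1 h2 h3 h4
    rw [hv, Perm.mul_apply, s_apply, hlo]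
    have g1 : w q ≠ w r := fun hh => h1 (w.injective hh)
    have g2 : w q ≠ w t := fun hh => h2 (w.injective hh)
    have g3 : w q ≠ w (-r) := fun hh => h3 (w.injective hh)
    have g4 : w q ≠ w (-t) := fun hh => h4 (w.injective hh)
    rw [h.1] at g3 g4
    rw [if_neg (by omega), if_neg (by omega), if_neg (by omega), if_neg (by omega)]
  have ir : i0 ≠ r := by rintro rfl; omega
  have it : i0 ≠ t := by rintro rfl; omega
  have vi : v i0 = a + 2 := by rw [hvq _ ir it (by omega) (by omega), wi]
  have hd : desc a w := by
    unfold desc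
    have e1 : w⁻¹ ((a : ℤ) + 1) = -t := by rw [Perm.inv_eq_iff_eq, h.1, wt]; omega
    have e2 : w⁻¹ (a : ℤ) = -r := by rw [Perm.inv_eq_iff_eq, h.1, wr]; omega
    rw [hlo, e1, e2]; omega
  have hl := ell_desc h (by omega) hd
  rw [← hv] at hl
  have e1 : v * T r t = w := by
    have : T (-((a : ℤ) + 1)) (-(a : ℤ)) = s a := by
      rw [T_neg (by omega) (by omega), T_comm, s, hlo]
    rw [conj hvB, vr, vt, this, hv, s_mul_s_mul]
  have e2 : v * T r (-i0) = s (a + 1) * v := by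
    rw [conj hvB, hvB.1, vr, vi, T_neg (by omega) (by omega), s, hlo1]
    push_cast
    rfl
  have ht : term (K + 1) r v t = term (K + 1) r v (-i0) := by
    apply two_terms (by omega) (by omega) hvB (by omega) (by omega) (by omega) (by omega)
      (by omega)
    intro q hq0 hq1 hq2 hqb1 hqb2
    rw [vr]
    constructor
    · intro c1 c2
      have e := hvq q (by omega) hq1 (by omega) (by omega)
      have c3 : t < q := by
        by_contra hc
        have := H1 q c1 (by omega)
        omega
      have c4 : v q ≠ v t := fun hh => hq1 (v.injective hh)
      apply noncover_A hvB' (p := t) <;> first | omega | (rw [abs_le]; push_cast; omega)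
    · intro c1 c2
      have hq : q < 0 := by
        by_contra hc
        have e := hvq q (by omega) hq1 (by omega) (by omega)
        have := H2 q (by omega) c1
        omega
      obtain ⟨i, rfl⟩ : ∃ i, q = -i := ⟨-q, by omega⟩
      rw [hvB.1] at c2
      have i1 : i ≠ r := by rintro rfl; omega
      have i2 : i ≠ t := by rintro rfl; omega
      have e := hvq i i1 i2 (by omega) (by omega)
      have c4 : v i ≠ v i0 := fun hh => hq2 (by rw [v.injective hh])
      have := H3 i (by omega) (by omega)
      have g1 := hvB.1 i
      have g2 := hvB.1 i0
      rw [T_comm]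
      apply noncover_A hvB' (p := -i0) <;> first | omega | (rw [abs_le]; push_cast; omega)
  obtain ⟨t1, t2⟩ := term_transfer (by rw [e1]; exact h.mono (by omega)) ht (by rw [e1]; omega)
  rw [e2, hv] at t1 t2
  rw [← hv, e1, hv] at t2
  refine ⟨(Bn_s (by omega)).mul ((Bn_s (by omega)).mul h), t2, ?_⟩
  rw [t1, ← hv, hl]

/-- values along the second chain -/
def Uf (n r j : ℕ) (p : ℤ) : ℤ :=
  if p < r then -p else if p = r then -(r + 2 * j) else
  if p ≤ n then (if (j : ℤ) ≤ n - p then -(r + 2 * (n - p) + 1) else -(r + 2 * (n - p)))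
  else if p ≤ 2 * n - r then (if p - n ≤ j then r + 2 * (p - n) - 1 else r + 2 * (p - n))
  else p

lemma Uf_step {n r j : ℕ} (hr : 1 ≤ r) (hj : r + j + 1 ≤ n) {w : Perm ℤ} (h : Bn (2 * n) w)
    (hw : ∀ p, 0 < p → w p = Uf n r j p) :
    ∃ w' : Perm ℤ, Bn (2 * n) w' ∧ (∀ p, 0 < p → w' p = Uf n r (j + 1) p) ∧
      N (2 * n + 1) w' = N (2 * n + 1) w ∧ ell w' = ell w := by
  have wr : w r = -((r + 2 * j : ℕ) : ℤ) := by
    rw [hw r (by omega), Uf, if_neg (by omega), if_pos rfl]; push_cast; rfl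
  have wt : w (n - j) = -((r + 2 * j : ℕ) + 1 : ℤ) := by
    rw [hw _ (by omega), Uf, if_neg (by omega), if_neg (by omega), if_pos (by omega),
      if_pos (by omega)]; push_cast; ring
  have wi : w (n + j + 1) = ((r + 2 * j : ℕ) : ℤ) + 2 := by
    rw [hw _ (by omega), Uf, if_neg (by omega), if_neg (by omega), if_neg (by omega),
      if_pos (by omega), if_neg (by omega)]; push_cast; ring
  obtain ⟨c1, c2, c3⟩ := chain2_step h (a := r + 2 * j) (by omega) (by omega) (by omega)
    (by push_cast; omega) (by omega) (by push_cast; omega) wr wt wi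
    (by
      intro q h1 h2
      rw [hw q (by omega), Uf]
      push_cast
      split_ifs <;> omega)
    (by
      intro q h1 h2
      rw [hw q (by omega), Uf]
      push_cast
      split_ifs <;> omega)
    (by
      intro q h1 h2
      rw [hw q (by omega), Uf] at h2
      push_cast at h2
      split_ifs at h2 <;> omega)
  refine ⟨_, c1, ?_, c2, c3⟩
  intro p hp
  rw [Perm.mul_apply, Perm.mul_apply]
  have hlo : lo (r + 2 * j) = r + 2 * j := by unfold lo; rw [if_neg (by omega)]; push_cast; rfl
  have hlo1 : lo (r + 2 * j + 1) = r + 2 * j + 1 := by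
    unfold lo; rw [if_neg (by omega)]; push_cast; rfl
  by_cases q1 : p = r
  · rw [q1, wr, s_apply (r + 2 * j), hlo]
    push_cast
    rw [if_neg (by omega), if_neg (by omega), if_pos (by omega), s_apply, hlo1]
    push_cast
    rw [if_neg (by omega), if_neg (by omega), if_pos (by omega), Uf, if_neg (by omega), if_pos rfl]
    push_cast; ring
  by_cases q2 : p = n - j
  · rw [q2, wt, s_apply (r + 2 * j), hlo]
    push_cast
    rw [if_neg (by omega), if_neg (by omega), if_neg (by omega), if_pos (by omega), s_apply, hlo1]
    push_cast
    rw [if_neg (by omega), if_neg (by omega), if_neg (by omega), if_neg (by omega), Uf,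
      if_neg (by omega), if_neg (by omega), if_pos (by omega), if_neg (by push_cast; omega)]
    push_cast; ring
  by_cases q3 : p = n + j + 1
  · rw [q3, wi, s_apply (r + 2 * j), hlo]
    push_cast
    rw [if_neg (by omega), if_neg (by omega), if_neg (by omega), if_neg (by omega), s_apply, hlo1]
    push_cast
    rw [if_neg (by omega), if_pos (by omega), Uf,
      if_neg (by omega), if_neg (by omega), if_neg (by omega), if_pos (by omega),
      if_pos (by push_cast; omega)]
    push_cast; ring
  have g1 : w p ≠ w r := fun hh => q1 (w.injective hh)
  have g2 : w p ≠ w (n - j) := fun hh => q2 (w.injective hh)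
  have g3 : w p ≠ w (n + j + 1) := fun hh => q3 (w.injective hh)
  have g4 : w p ≠ w (-r) := fun hh => by have := w.injective hh; omega
  have g5 : w p ≠ w (-(n - j)) := fun hh => by have := w.injective hh; omega
  have g6 : w p ≠ w (-(n + j + 1)) := fun hh => by have := w.injective hh; omega
  rw [h.1] at g4 g5 g6
  rw [wr] at g1 g4
  rw [wt] at g2 g5
  rw [wi] at g3 g6
  push_cast at g1 g2 g3 g4 g5 g6
  rw [s_apply (r + 2 * j), hlo]
  push_cast
  rw [if_neg (by omega), if_neg (by omega), if_neg (by omega), if_neg (by omega), s_apply, hlo1]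
  push_cast
  rw [if_neg (by omega), if_neg (by omega), if_neg (by omega), if_neg (by omega), hw p hp, Uf, Uf]
  push_cast
  split_ifs <;> omega

lemma chain2_row {n r : ℕ} (hr : 1 ≤ r) {w : Perm ℤ} (h : Bn (2 * n) w)
    (hw : ∀ p, 0 < p → w p = Uf n r 0 p) : ∀ j : ℕ, r + j ≤ n →
    ∃ w' : Perm ℤ, Bn (2 * n) w' ∧ (∀ p, 0 < p → w' p = Uf n r j p) ∧
      N (2 * n + 1) w' = N (2 * n + 1) w ∧ ell w' = ell w := by
  intro j
  induction j with
  | zero => intro _; exact ⟨w, h, hw, rfl, rfl⟩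
  | succ j ih =>
    intro hj
    obtain ⟨w1, a1, a2, a3, a4⟩ := ih (by omega)
    obtain ⟨w2, b1, b2, b3, b4⟩ := Uf_step hr (by omega) a1 a2
    exact ⟨w2, b1, b2, b3.trans a3, b4.trans a4⟩

lemma chain2 (n : ℕ) : ∀ m : ℕ, m ≤ n → ∃ w : Perm ℤ, Bn (2 * n) w ∧
    (∀ p, 0 < p → w p = Uf n (n - m) 0 p) ∧ N (2 * n + 1) w = N (2 * n + 1) (w0 n) ∧
    ell w = ell (w0 n) := by
  intro m
  induction m with
  | zero =>
    intro _
    refine ⟨w0 n, (Bn_w0 n).mono (by omega), ?_, rfl, rfl⟩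
    intro p hp
    rw [w0_apply, Uf]
    split_ifs <;> push_cast at * <;> omega
  | succ m ih =>
    intro hm
    obtain ⟨w1, a1, a2, a3, a4⟩ := ih (by omega)
    obtain ⟨w2, b1, b2, b3, b4⟩ := chain2_row (r := n - m) (by omega) a1 a2 m (by omega)
    refine ⟨w2, b1, ?_, b3.trans a3, b4.trans a4⟩
    intro p hp
    rw [b2 p hp, Uf, Uf]
    obtain ⟨r, hr⟩ : ∃ r, n = r + (m + 1) := ⟨n - (m + 1), by omega⟩
    have e1 : n - m = r + 1 := by omega
    have e2 : n - (m + 1) = r := by omega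
    rw [e1, e2]
    push_cast
    split_ifs <;> omega

end BW

namespace BW

open Equiv

/-- removable cells -/
def corner (cells : ℕ × ℕ → Prop) (c : ℕ × ℕ) : Prop :=
  cells c ∧ ¬ cells (c.1, c.2 + 1) ∧ ¬ cells (c.1 + 1, c.2)

lemma fill_congr {C C' : ℕ × ℕ → Prop} (h : ∀ c, C c ↔ C' c) {d : ℕ} {f : ℕ × ℕ → ℕ} :
    IsStdFilling C d f ↔ IsStdFilling C' d f := by
  have : C = C' := funext fun c => propext (h c)
  rw [this]

lemma fill_extend {C : ℕ × ℕ → Prop} {c : ℕ × ℕ} (hc : corner C c) {d : ℕ} {g : ℕ × ℕ → ℕ}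
    (hg : IsStdFilling (fun x => C x ∧ x ≠ c) d g) :
    IsStdFilling C (d + 1) (Function.update g c (d + 1)) := by
  obtain ⟨g1, g2, g3, g4, g5, g6⟩ := hg
  obtain ⟨c1, c2, c3⟩ := hc
  refine ⟨?_, ?_, ?_, ?_, ?_, ?_⟩
  · intro x hx
    have : x ≠ c := by rintro rfl; exact hx c1
    rw [Function.update_of_ne this]
    exact g1 x (fun hh => hx hh.1)
  · intro x hx
    by_cases hxc : x = c
    · subst hxc; simp
    · rw [Function.update_of_ne hxc]
      have := g2 x ⟨hx, hxc⟩
      omega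
  · intro x y hx hy hxy
    by_cases hxc : x = c
    · by_cases hyc : y = c
      · rw [hxc, hyc]
      · subst hxc
        rw [Function.update_self, Function.update_of_ne hyc] at hxy
        have := g2 y ⟨hy, hyc⟩
        omega
    · by_cases hyc : y = c
      · subst hyc
        rw [Function.update_self, Function.update_of_ne hxc] at hxy
        have := g2 x ⟨hx, hxc⟩
        omega
      · rw [Function.update_of_ne hxc, Function.update_of_ne hyc] at hxy
        exact g3 x y ⟨hx, hxc⟩ ⟨hy, hyc⟩ hxy
  · intro v hv1 hv2
    by_cases hvd : v = d + 1
    · exact ⟨c, c1, by rw [Function.update_self, hvd]⟩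
    · obtain ⟨x, hx, hxv⟩ := g4 v hv1 (by omega)
      exact ⟨x, hx.1, by rw [Function.update_of_ne hx.2, hxv]⟩
  · intro a b h1 h2
    have hne : (a, b) ≠ c := by rintro rfl; exact c2 h2
    rw [Function.update_of_ne hne]
    by_cases h3 : (a, b + 1) = c
    · rw [h3, Function.update_self]
      have := g2 (a, b) ⟨h1, hne⟩
      omega
    · rw [Function.update_of_ne h3]
      exact g5 a b ⟨h1, hne⟩ ⟨h2, h3⟩
  · intro a b h1 h2
    have hne : (a, b) ≠ c := by rintro rfl; exact c3 h2
    rw [Function.update_of_ne hne]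
    by_cases h3 : (a + 1, b) = c
    · rw [h3, Function.update_self]
      have := g2 (a, b) ⟨h1, hne⟩
      omega
    · rw [Function.update_of_ne h3]
      exact g6 a b ⟨h1, hne⟩ ⟨h2, h3⟩

lemma fill_restrict {C : ℕ × ℕ → Prop} {d : ℕ} {f : ℕ × ℕ → ℕ}
    (hf : IsStdFilling C (d + 1) f) :
    ∃ c, corner C c ∧ ∃ g, IsStdFilling (fun x => C x ∧ x ≠ c) d g ∧
      Function.update g c (d + 1) = f := by
  obtain ⟨g1, g2, g3, g4, g5, g6⟩ := hf
  obtain ⟨c, hc, hcf⟩ := g4 (d + 1) (by omega) (by omega)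
  refine ⟨c, ⟨hc, ?_, ?_⟩, Function.update f c 0, ⟨?_, ?_, ?_, ?_, ?_, ?_⟩, ?_⟩
  · intro hh
    have := g5 c.1 c.2 hc hh
    have := g2 _ hh
    have e : f (c.1, c.2) = d + 1 := hcf
    omega
  · intro hh
    have := g6 c.1 c.2 hc hh
    have := g2 _ hh
    have e : f (c.1, c.2) = d + 1 := hcf
    omega
  · intro x hx
    by_cases hxc : x = c
    · subst hxc; simp
    · rw [Function.update_of_ne hxc]
      exact g1 x (fun hh => hx ⟨hh, hxc⟩)
  · rintro x ⟨hx, hxc⟩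
    rw [Function.update_of_ne hxc]
    have := g2 x hx
    have : f x ≠ d + 1 := fun hh => hxc (g3 x c hx hc (by omega))
    omega
  · rintro x y ⟨hx, hxc⟩ ⟨hy, hyc⟩ hxy
    rw [Function.update_of_ne hxc, Function.update_of_ne hyc] at hxy
    exact g3 x y hx hy hxy
  · intro v hv1 hv2
    obtain ⟨x, hx, hxv⟩ := g4 v hv1 (by omega)
    have hxc : x ≠ c := by rintro rfl; omega
    exact ⟨x, ⟨hx, hxc⟩, by rw [Function.update_of_ne hxc, hxv]⟩
  · rintro a b ⟨h1, h1'⟩ ⟨h2, h2'⟩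
    rw [Function.update_of_ne h1', Function.update_of_ne h2']
    exact g5 a b h1 h2
  · rintro a b ⟨h1, h1'⟩ ⟨h2, h2'⟩
    rw [Function.update_of_ne h1', Function.update_of_ne h2']
    exact g6 a b h1 h2
  · rw [Function.update_idem, ← hcf, Function.update_eq_self]

theorem count {M : ℕ} (fam : Perm ℤ → Prop) (cells : Perm ℤ → ℕ × ℕ → Prop)
    (cor : ℕ → Perm ℤ → ℕ × ℕ) (hB : ∀ w, fam w → Bn M w)
    (hfam : ∀ w k, fam w → desc k w → fam (s k * w))
    (hcor : ∀ w k, fam w → desc k w → corner (cells w) (cor k w))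
    (hcells : ∀ w k, fam w → desc k w → ∀ c, cells (s k * w) c ↔ cells w c ∧ c ≠ cor k w)
    (hsurj : ∀ w c, fam w → corner (cells w) c → ∃ k, desc k w ∧ cor k w = c)
    (hinj : ∀ w k k', fam w → desc k w → desc k' w → cor k w = cor k' w → k = k')
    (h1 : fam 1 → ∀ c, ¬ cells 1 c) :
    ∀ d w, fam w → ell w = d → ∃ S : Finset (ℕ × ℕ → ℕ),
      (∀ f, f ∈ S ↔ IsStdFilling (cells w) d f) ∧ S.card = N M w := by
  classical
  intro d
  induction d with
  | zero =>
    intro w hw hd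
    have := eq_one_of_ell (hB w hw) hd
    subst this
    refine ⟨{fun _ => 0}, ?_, ?_⟩
    · intro f
      rw [Finset.mem_singleton]
      constructor
      · rintro rfl
        refine ⟨fun _ _ => rfl, fun c hc => absurd hc (h1 hw c),
          fun c _ hc => absurd hc (h1 hw c), fun v _ _ => by omega,
          fun a b hc => absurd hc (h1 hw _), fun a b hc => absurd hc (h1 hw _)⟩
      · intro hf
        funext c
        exact hf.1 c (h1 hw c)
    · rw [N_one]; simp
  | succ d ih =>
    intro w hw hd
    have hw1 : w ≠ 1 := by rintro rfl; rw [ell_one] at hd; omega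
    have hkM : ∀ k, desc k w → k < M := by
      intro k hk
      by_contra hc
      exact not_desc_of_le (hB w hw) (by omega) hk
    have ih' : ∀ k, ∃ S : Finset (ℕ × ℕ → ℕ), desc k w →
        ((∀ f, f ∈ S ↔ IsStdFilling (cells (s k * w)) d f) ∧ S.card = N M (s k * w)) := by
      intro k
      by_cases hk : desc k w
      · have := ell_desc (hB w hw) (hkM k hk) hk
        obtain ⟨S, hS⟩ := ih (s k * w) (hfam w k hw hk) (by omega)
        exact ⟨S, fun _ => hS⟩
      · exact ⟨∅, fun hh => absurd hh hk⟩
    choose S hS using ih'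
    have hSc : ∀ k, desc k w → ∀ f, f ∈ S k ↔
        IsStdFilling (fun x => cells w x ∧ x ≠ cor k w) d f := by
      intro k hk f
      rw [(hS k hk).1]
      exact fill_congr (hcells w k hw hk)
    have hval : ∀ k, desc k w → ∀ f, f ∈ (S k).image (fun g => Function.update g (cor k w) (d+1)) →
        f (cor k w) = d + 1 ∧ IsStdFilling (cells w) (d + 1) f := by
      intro k hk f hf
      rw [Finset.mem_image] at hf
      obtain ⟨g, hg, rfl⟩ := hf
      exact ⟨Function.update_self .., fill_extend (hcor w k hw hk) ((hSc k hk g).1 hg)⟩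
    refine ⟨((Finset.range M).filter (fun k => desc k w)).biUnion
      (fun k => (S k).image (fun g => Function.update g (cor k w) (d+1))), ?_, ?_⟩
    · intro f
      rw [Finset.mem_biUnion]
      constructor
      · rintro ⟨k, hk, hf⟩
        rw [Finset.mem_filter] at hk
        exact (hval k hk.2 f hf).2
      · intro hf
        obtain ⟨c, hc, g, hg, hgf⟩ := fill_restrict hf
        obtain ⟨k, hk, rfl⟩ := hsurj w c hw hc
        refine ⟨k, Finset.mem_filter.2 ⟨Finset.mem_range.2 (hkM k hk), hk⟩, ?_⟩
        rw [Finset.mem_image]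
        exact ⟨g, (hSc k hk g).2 hg, hgf⟩
    · rw [Finset.card_biUnion, N_rec (hB w hw) hw1, Finset.sum_filter]
      · apply Finset.sum_congr rfl
        intro k _
        by_cases hk : desc k w
        · rw [if_pos hk, if_pos hk, Finset.card_image_of_injOn, (hS k hk).2]
          intro g hg g' hg' he
          have z : g (cor k w) = 0 := ((hSc k hk g).1 hg).1 _ (fun hh => hh.2 rfl)
          have z' : g' (cor k w) = 0 := ((hSc k hk g').1 hg').1 _ (fun hh => hh.2 rfl)
          funext x
          by_cases hx : x = cor k w
          · rw [hx, z, z']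
          · have := congrFun he x
            simpa [Function.update_of_ne hx] using this
        · rw [if_neg hk, if_neg hk]
      · intro k hk k' hk' hkk
        simp only [Finset.coe_filter, Set.mem_ofPred_eq] at hk hk'
        rw [Function.onFun, Finset.disjoint_left]
        intro f hf hf'
        have a1 := hval k hk.2 f hf
        have a2 := hval k' hk'.2 f hf'
        apply hkk
        apply hinj w k k' hw hk.2 hk'.2
        exact a1.2.2.2.1 _ _ (hcor w k hw hk.2).1 (hcor w k' hw hk'.2).1 (by omega)

theorem count_ncard {M : ℕ} (fam : Perm ℤ → Prop) (cells : Perm ℤ → ℕ × ℕ → Prop)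
    (cor : ℕ → Perm ℤ → ℕ × ℕ) (hB : ∀ w, fam w → Bn M w)
    (hfam : ∀ w k, fam w → desc k w → fam (s k * w))
    (hcor : ∀ w k, fam w → desc k w → corner (cells w) (cor k w))
    (hcells : ∀ w k, fam w → desc k w → ∀ c, cells (s k * w) c ↔ cells w c ∧ c ≠ cor k w)
    (hsurj : ∀ w c, fam w → corner (cells w) c → ∃ k, desc k w ∧ cor k w = c)
    (hinj : ∀ w k k', fam w → desc k w → desc k' w → cor k w = cor k' w → k = k')
    (h1 : fam 1 → ∀ c, ¬ cells 1 c) {w : Perm ℤ} (hw : fam w) :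
    {f | IsStdFilling (cells w) (ell w) f}.ncard = N M w := by
  obtain ⟨S, hS, hc⟩ := count fam cells cor hB hfam hcor hcells hsurj hinj h1 _ w hw rfl
  have : {f | IsStdFilling (cells w) (ell w) f} = ↑S := by
    ext f; simp [hS]
  rw [this, Set.ncard_coe_finset, hc]

end BW

namespace BW

open Equiv

/-- Grassmannian-type elements indexing shifted shapes -/
def famS (M : ℕ) (w : Perm ℤ) : Prop := Bn M w ∧ ∀ i j, 0 < i → i < j → w i < w j

/-- cells of the shifted shape -/
def cellS (w : Perm ℤ) (c : ℕ × ℕ) : Prop :=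
  c.1 ≤ c.2 ∧ w ((c.1 : ℤ) + 1) + w ((c.2 : ℤ) + 1) < 0

/-- corner attached to a descent -/
def corS (k : ℕ) (w : Perm ℤ) : ℕ × ℕ :=
  ((w⁻¹ (-((k : ℤ) + 1)) - 1).toNat, (w⁻¹ (lo k) - 1).toNat)

lemma lo_cases (k : ℕ) : (k = 0 ∧ lo k = -1) ∨ (1 ≤ k ∧ lo k = k) := by
  unfold lo; split_ifs <;> omega

lemma descS {M k : ℕ} {w : Perm ℤ} (h : famS M w) (hd : desc k w) :
    ∃ A B : ℤ, 0 < A ∧ A ≤ B ∧ (A = B → k = 0) ∧ w A = -((k : ℤ) + 1) ∧ w B = lo k ∧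
      corS k w = ((A - 1).toNat, (B - 1).toNat) := by
  obtain ⟨hB, hi⟩ := h
  obtain ⟨A, hA⟩ : ∃ A, A = w⁻¹ (-((k : ℤ) + 1)) := ⟨_, rfl⟩
  obtain ⟨B, hBe⟩ : ∃ B, B = w⁻¹ (lo k) := ⟨_, rfl⟩
  have wA : w A = -((k : ℤ) + 1) := by rw [hA, app_inv]
  have wB : w B = lo k := by rw [hBe, app_inv]
  have wnA : w (-A) = (k : ℤ) + 1 := by rw [hB.1, wA]; omega
  have wnB : w (-B) = - lo k := by rw [hB.1, wB]
  have hA0 : A ≠ 0 := by rintro rfl; rw [hB.zero] at wA; omega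
  have hB0 : B ≠ 0 := by rintro rfl; rw [hB.zero] at wB; exact lo_ne k wB.symm
  unfold desc at hd
  rw [← hBe, ← neg_neg ((k : ℤ) + 1), hB.inv.1, ← hA] at hd
  have hl := lo_cases k
  have a1 : 0 < A := by
    by_contra hc
    have := hi (-A) B (by omega) hd
    omega
  have a2 : 0 < B := by
    by_contra hc
    have := hi (-B) A (by omega) (by omega)
    omega
  refine ⟨A, B, a1, ?_, ?_, wA, wB, by rw [corS, ← hA, ← hBe]⟩
  · by_contra hc
    have := hi B A a2 (by omega)
    omega
  · intro hAB
    rw [hAB, wB] at wA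
    omega

lemma s_lo (k : ℕ) : s k (lo k) = k + 1 := by rw [s_apply]; simp

lemma famS_step {M k : ℕ} {w : Perm ℤ} (h : famS M w) (hd : desc k w) : famS M (s k * w) := by
  have hk : k < M := by
    by_contra hc
    exact not_desc_of_le h.1 (by omega) hd
  obtain ⟨A, B, hA, hAB, hk0, wA, wB, _⟩ := descS h hd
  refine ⟨(Bn_s hk).mul h.1, ?_⟩
  intro i j hi hij
  have hlt := h.2 i j hi hij
  rw [Perm.mul_apply, Perm.mul_apply]
  by_contra hc
  have hne : s k (w i) ≠ s k (w j) := fun hh => by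
    have := (s k).injective hh; omega
  have w1 : w (-A) = (k : ℤ) + 1 := by rw [h.1.1, wA]; omega
  have w2 : w (-B) = -lo k := by rw [h.1.1, wB]
  rcases s_flip k (h.1.ne (by omega)) (h.1.ne (by omega)) hlt (by omega) with ⟨e1, e2⟩ | ⟨e1, e2⟩
  · have := w.injective (e2.trans w1.symm); omega
  · have := w.injective (e2.trans w2.symm); omega

lemma corS_corner {M k : ℕ} {w : Perm ℤ} (h : famS M w) (hd : desc k w) :
    corner (cellS w) (corS k w) := by
  obtain ⟨A, B, hA, hAB, hk0, wA, wB, hc⟩ := descS h hd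
  rw [hc]
  have eA : (((A - 1).toNat : ℕ) : ℤ) + 1 = A := by omega
  have eB : (((B - 1).toNat : ℕ) : ℤ) + 1 = B := by omega
  have hl := lo_cases k
  unfold corner cellS
  dsimp only
  push_cast
  rw [eA, eB, wA, wB]
  refine ⟨⟨by omega, by omega⟩, ?_, ?_⟩
  · rintro ⟨_, h2⟩
    have := h.2 B (B + 1) (by omega) (by omega)
    have := h.1.ne (i := B + 1) (by omega)
    omega
  · rintro ⟨h1, h2⟩
    have := h.2 A (A + 1) (by omega) (by omega)
    have hk : k ≠ 0 := by
      intro hk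
      have e : w A = w B := by omega
      have := w.injective e
      omega
    omega

lemma cellS_step {M k : ℕ} {w : Perm ℤ} (h : famS M w) (hd : desc k w) (c : ℕ × ℕ) :
    cellS (s k * w) c ↔ cellS w c ∧ c ≠ corS k w := by
  have hk : k < M := by
    by_contra hc
    exact not_desc_of_le h.1 (by omega) hd
  obtain ⟨A, B, hA, hAB, hk0, wA, wB, hc⟩ := descS h hd
  obtain ⟨a, b⟩ := c
  rw [hc, Ne, Prod.mk.injEq]
  have hl := lo_cases k
  have hsB := (Bn_s (K := M) hk)
  obtain ⟨x, hx⟩ : ∃ x : ℤ, x = a + 1 := ⟨_, rfl⟩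
  obtain ⟨y, hy⟩ : ∃ y : ℤ, y = b + 1 := ⟨_, rfl⟩
  have e : (a = (A - 1).toNat ∧ b = (B - 1).toNat) ↔ (x = A ∧ y = B) := by omega
  rw [e]
  unfold cellS
  dsimp only
  rw [← hx, ← hy, Perm.mul_apply, Perm.mul_apply]
  have w1 : w (-A) = (k : ℤ) + 1 := by rw [h.1.1, wA]; omega
  have w2 : w (-B) = -lo k := by rw [h.1.1, wB]
  have sy : s k (w (-y)) = - s k (w y) := by rw [h.1.1, hsB.1]
  have wy := h.1.1 y
  have nx := h.1.ne (i := x) (by omega)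
  have ny := h.1.ne (i := -y) (by omega)
  by_cases hxy : a ≤ b
  swap
  · simp [hxy]
  simp only [hxy, true_and]
  constructor
  · intro hs
    constructor
    · by_contra hcc
      rcases lt_or_eq_of_le (not_lt.1 hcc) with hlt | heq
      · rcases s_flip k ny nx (by omega) (by omega) with ⟨e1, e2⟩ | ⟨e1, e2⟩
        · have := w.injective (e1.trans wB.symm); omega
        · have := w.injective (e1.trans wA.symm); omega
      · have e1 : w x = w (-y) := by omega
        have := w.injective e1
        omega
    · rintro ⟨rfl, rfl⟩
      rw [wA, wB, s_lo, hsB.1, s_hi] at hs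
      omega
  · rintro ⟨hlt, hne⟩
    by_contra hcc
    have hne2 : s k (w x) ≠ s k (w (-y)) := fun hh => by
      have := w.injective ((s k).injective hh); omega
    rcases s_flip k nx ny (by omega) (by omega) with ⟨e1, e2⟩ | ⟨e1, e2⟩
    · have g1 := w.injective (e1.trans wB.symm)
      have g2 := w.injective (e2.trans w1.symm)
      apply hne
      omega
    · have g1 := w.injective (e1.trans wA.symm)
      have g2 := w.injective (e2.trans w2.symm)
      apply hne
      omega

lemma famS_mono {M : ℕ} {w : Perm ℤ} (h : famS M w) {i j : ℤ} (hi : 0 < i) (hj : 0 < j)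
    (hw : w i < w j) : i < j := by
  by_contra hc
  rcases lt_or_eq_of_le (not_lt.1 hc) with h1 | h1
  · have := h.2 j i hj h1; omega
  · subst h1; omega

lemma famS_mono' {M : ℕ} {w : Perm ℤ} (h : famS M w) {i j : ℤ} (hi : 0 < i) (hij : i ≤ j) :
    w i ≤ w j := by
  rcases lt_or_eq_of_le hij with h1 | h1
  · have := h.2 i j hi h1; omega
  · subst h1; omega

/-- the positive position holding a value up to sign -/
lemma abs_pos {M : ℕ} {w : Perm ℤ} (h : Bn M w) {m : ℤ} (hm : m ≠ 0) :
    ∃ q, 0 < q ∧ (w q = m ∨ w q = -m) := by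
  obtain ⟨q, hq⟩ : ∃ q, w q = m := ⟨w⁻¹ m, app_inv _ _⟩
  have : q ≠ 0 := by rintro rfl; rw [h.zero] at hq; omega
  by_cases h0 : 0 < q
  · exact ⟨q, h0, Or.inl hq⟩
  · exact ⟨-q, by omega, Or.inr (by rw [h.1, hq])⟩

lemma surjS {M : ℕ} {w : Perm ℤ} (h : famS M w) (c : ℕ × ℕ) (hc : corner (cellS w) c) :
    ∃ k, desc k w ∧ corS k w = c := by
  obtain ⟨a, b⟩ := c
  obtain ⟨⟨c0, c1⟩, c2, c3⟩ := hc
  unfold cellS at c2 c3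
  dsimp only at c0 c1 c2 c3
  push_cast at c2 c3
  obtain ⟨x, hx⟩ : ∃ x : ℤ, x = a + 1 := ⟨_, rfl⟩
  obtain ⟨y, hy⟩ : ∃ y : ℤ, y = b + 1 := ⟨_, rfl⟩
  rw [← hx, ← hy] at c1 c2 c3
  have d2 : 0 ≤ w x + w (y + 1) := by
    by_contra hcc
    exact c2 ⟨by omega, by omega⟩
  suffices hs : ∃ k : ℕ, w x = -((k : ℤ) + 1) ∧ w y = lo k by
    obtain ⟨k, k1, k2⟩ := hs
    have i1 : w⁻¹ (-((k : ℤ) + 1)) = x := by rw [Perm.inv_eq_iff_eq, k1]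
    have i2 : w⁻¹ (lo k) = y := by rw [Perm.inv_eq_iff_eq, k2]
    have i3 : w⁻¹ ((k : ℤ) + 1) = -x := by rw [← i1, h.1.inv.1]; omega
    refine ⟨k, ?_, ?_⟩
    · unfold desc
      rw [i2, i3]; omega
    · rw [corS, i1, i2, Prod.mk.injEq]; omega
  by_cases hxy : x = y
  · subst hxy
    refine ⟨0, ?_⟩
    have : w x = -1 := by
      by_contra hne
      obtain ⟨q, hq, hqv⟩ := abs_pos h.1 (m := -w x - 1) (by omega)
      have := famS_mono h (i := x) (j := q) (by omega) hq (by omega)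
      have := famS_mono' h (i := x + 1) (j := q) (by omega) (by omega)
      omega
    rw [this]; simp [lo]
  · have d3 : 0 ≤ w (x + 1) + w y := by
      by_contra hcc
      exact c3 ⟨by omega, by omega⟩
    have := famS_mono' h (i := x + 1) (j := y) (by omega) (by omega)
    have ny := h.1.ne (i := y) (by omega)
    obtain ⟨k, hk⟩ : ∃ k : ℕ, w y = k := ⟨(w y).toNat, by omega⟩
    refine ⟨k, ?_, ?_⟩
    · obtain ⟨q, hq, hqv⟩ := abs_pos h.1 (m := (k : ℤ) + 1) (by omega)
      rcases hqv with hqv | hqv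
      · have := famS_mono h (i := y) (j := q) (by omega) hq (by omega)
        have := famS_mono' h (i := y + 1) (j := q) (by omega) (by omega)
        omega
      · by_contra hne
        have := famS_mono h (i := x) (j := q) (by omega) hq (by omega)
        have := famS_mono' h (i := x + 1) (j := q) (by omega) (by omega)
        omega
    · rw [hk, lo, if_neg (by omega)]

lemma injS {M : ℕ} {w : Perm ℤ} (k k' : ℕ) (h : famS M w) (hd : desc k w) (hd' : desc k' w)
    (he : corS k w = corS k' w) : k = k' := by
  obtain ⟨A, B, hA, hAB, hk0, wA, wB, hc⟩ := descS h hd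
  obtain ⟨A', B', hA', hAB', hk0', wA', wB', hc'⟩ := descS h hd'
  rw [hc, hc', Prod.mk.injEq] at he
  have : A = A' := by omega
  subst this
  omega

theorem count_shifted {M : ℕ} {w : Perm ℤ} (h : famS M w) :
    {f | IsStdFilling (cellS w) (ell w) f}.ncard = N M w := by
  apply count_ncard (famS M) cellS corS (fun _ h => h.1) (fun _ _ h => famS_step h)
    (fun _ _ h => corS_corner h) (fun _ _ h => cellS_step h) (fun _ c h => surjS h c)
    (fun _ k k' h => injS k k' h) _ h
  rintro - ⟨a, b⟩ ⟨_, h2⟩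
  simp only [Perm.one_apply] at h2
  omega

/-! straight shapes -/

/-- Grassmannian elements indexing straight shapes -/
def famR (M n : ℕ) (w : Perm ℤ) : Prop := Bn M w ∧ (∀ i, 0 < i → 0 < w i) ∧
  (∀ i j : ℤ, 0 < i → i < j → j ≤ n → w i < w j) ∧ (∀ i j : ℤ, (n : ℤ) < i → i < j → w i < w j)

/-- cells of the straight shape -/
def cellR (n : ℕ) (w : Perm ℤ) (c : ℕ × ℕ) : Prop :=
  c.1 < n ∧ w (n + 1 + c.2) < w (n - c.1)

/-- corner attached to a descent -/
def corR (n k : ℕ) (w : Perm ℤ) : ℕ × ℕ :=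
  ((n - w⁻¹ ((k : ℤ) + 1)).toNat, (w⁻¹ (lo k) - n - 1).toNat)

lemma famR_pos {M n : ℕ} {w : Perm ℤ} (h : famR M n w) {x : ℤ} (hx : 0 < w x) : 0 < x := by
  by_contra hc
  have h0 : x ≠ 0 := by rintro rfl; rw [h.1.zero] at hx; omega
  have := h.2.1 (-x) (by omega)
  rw [h.1.1] at this
  omega

lemma descR {M n k : ℕ} {w : Perm ℤ} (h : famR M n w) (hd : desc k w) :
    ∃ A B : ℤ, 0 < A ∧ A ≤ n ∧ n < B ∧ 1 ≤ k ∧ w A = (k : ℤ) + 1 ∧ w B = k ∧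
      corR n k w = ((n - A).toNat, (B - n - 1).toNat) := by
  obtain ⟨A, hA⟩ : ∃ A, A = w⁻¹ ((k : ℤ) + 1) := ⟨_, rfl⟩
  obtain ⟨B, hBe⟩ : ∃ B, B = w⁻¹ (lo k) := ⟨_, rfl⟩
  have wA : w A = (k : ℤ) + 1 := by rw [hA, app_inv]
  have wB : w B = lo k := by rw [hBe, app_inv]
  have hl := lo_cases k
  unfold desc at hd
  rw [← hBe, ← hA] at hd
  have a1 : 0 < A := famR_pos h (by omega)
  have a2 := h.2.1 B (by omega)
  have c1 : A ≤ n := by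
    by_contra hc
    have := h.2.2.2 A B (by omega) hd
    omega
  have c2 : n < B := by
    by_contra hc
    have := h.2.2.1 A B (by omega) hd (by omega)
    omega
  exact ⟨A, B, a1, c1, c2, by omega, wA, by omega, by rw [corR, ← hA, ← hBe]⟩

lemma s_flip_pos {k : ℕ} (hk : 1 ≤ k) {x y : ℤ} (hx : 0 < x) (h : x < y) (h' : s k y < s k x) :
    x = k ∧ y = k + 1 := by
  have := lo_cases k
  rcases s_flip k (by omega) (by omega) h h' with ⟨e1, e2⟩ | ⟨e1, e2⟩ <;> omega

lemma famR_step {M n k : ℕ} {w : Perm ℤ} (h : famR M n w) (hd : desc k w) :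
    famR M n (s k * w) := by
  have hk : k < M := by
    by_contra hc
    exact not_desc_of_le h.1 (by omega) hd
  obtain ⟨A, B, hA, hAn, hnB, hk1, wA, wB, _⟩ := descR h hd
  have hinc : ∀ i j, 0 < i → i < j → w i < w j → ¬ (i = B ∧ j = A) →
      s k (w i) < s k (w j) := by
    intro i j hi hij hlt hne
    by_contra hc
    have hne2 : s k (w i) ≠ s k (w j) := fun hh => by
      have := (s k).injective hh; omega
    obtain ⟨e1, e2⟩ := s_flip_pos hk1 (h.2.1 i hi) hlt (by omega)
    exact hne ⟨w.injective (e1.trans wB.symm), w.injective (e2.trans wA.symm)⟩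
  refine ⟨(Bn_s hk).mul h.1, ?_, ?_, ?_⟩
  · intro i hi
    have := h.2.1 i hi
    have := lo_cases k
    rw [Perm.mul_apply, s_apply]
    split_ifs <;> omega
  · intro i j hi hij hj
    exact hinc i j hi hij (h.2.2.1 i j hi hij hj) (by omega)
  · intro i j hi hij
    exact hinc i j (by omega) hij (h.2.2.2 i j hi hij) (by omega)

lemma corR_corner {M n k : ℕ} {w : Perm ℤ} (h : famR M n w) (hd : desc k w) :
    corner (cellR n w) (corR n k w) := by
  obtain ⟨A, B, hA, hAn, hnB, hk1, wA, wB, hc⟩ := descR h hd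
  rw [hc]
  have eA : (n : ℤ) - (((n - A).toNat : ℕ) : ℤ) = A := by omega
  have eB : (n : ℤ) + 1 + (((B - n - 1).toNat : ℕ) : ℤ) = B := by omega
  unfold corner cellR
  dsimp only
  push_cast
  rw [← add_assoc, ← sub_sub, eA, eB, wA, wB]
  refine ⟨⟨by omega, by omega⟩, ?_, ?_⟩
  · rintro ⟨_, h2⟩
    have := h.2.2.2 B (B + 1) (by omega) (by omega)
    omega
  · rintro ⟨h1, h2⟩
    have := h.2.2.1 (A - 1) A (by omega) (by omega) hAn
    omega

lemma cellR_step {M n k : ℕ} {w : Perm ℤ} (h : famR M n w) (hd : desc k w) (c : ℕ × ℕ) :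
    cellR n (s k * w) c ↔ cellR n w c ∧ c ≠ corR n k w := by
  obtain ⟨A, B, hA, hAn, hnB, hk1, wA, wB, hc⟩ := descR h hd
  obtain ⟨a, b⟩ := c
  rw [hc, Ne, Prod.mk.injEq]
  have hl := lo_cases k
  unfold cellR
  dsimp only
  by_cases han : a < n
  swap
  · simp [han]
  obtain ⟨x, hx⟩ : ∃ x : ℤ, x = n - a := ⟨_, rfl⟩
  obtain ⟨y, hy⟩ : ∃ y : ℤ, y = n + 1 + b := ⟨_, rfl⟩
  have e : (a = (n - A).toNat ∧ b = (B - n - 1).toNat) ↔ (x = A ∧ y = B) := by omega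
  rw [e, ← hx, ← hy, Perm.mul_apply, Perm.mul_apply]
  simp only [han, true_and]
  have px := h.2.1 x (by omega)
  have py := h.2.1 y (by omega)
  constructor
  · intro hs
    constructor
    · by_contra hcc
      rcases lt_or_eq_of_le (not_lt.1 hcc) with hlt | heq
      · obtain ⟨e1, e2⟩ := s_flip_pos hk1 px hlt hs
        have := w.injective (e1.trans wB.symm)
        omega
      · rw [heq] at hs; omega
    · rintro ⟨rfl, rfl⟩
      have e1 : (k : ℤ) = lo k := by omega
      rw [wA, s_hi, wB, e1, s_lo] at hs
      omega
  · rintro ⟨hlt, hne⟩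
    by_contra hcc
    have hne2 : s k (w x) ≠ s k (w y) := fun hh => by
      have := (s k).injective hh; omega
    obtain ⟨e1, e2⟩ := s_flip_pos hk1 py hlt (by omega)
    exact hne ⟨w.injective (e2.trans wA.symm), w.injective (e1.trans wB.symm)⟩

lemma surjR {M n : ℕ} {w : Perm ℤ} (h : famR M n w) (c : ℕ × ℕ) (hc : corner (cellR n w) c) :
    ∃ k, desc k w ∧ corR n k w = c := by
  obtain ⟨a, b⟩ := c
  obtain ⟨⟨c0, c1⟩, c2, c3⟩ := hc
  unfold cellR at c2 c3
  dsimp only at c0 c1 c2 c3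
  push_cast at c2 c3
  rw [← add_assoc] at c2
  rw [← sub_sub] at c3
  obtain ⟨x, hx⟩ : ∃ x : ℤ, x = n - a := ⟨_, rfl⟩
  obtain ⟨y, hy⟩ : ∃ y : ℤ, y = n + 1 + b := ⟨_, rfl⟩
  rw [← hx, ← hy] at c1 c2 c3
  have py := h.2.1 y (by omega)
  obtain ⟨k, hk⟩ : ∃ k : ℕ, w y = k := ⟨(w y).toNat, by omega⟩
  have hl := lo_cases k
  obtain ⟨q, hq⟩ : ∃ q, w q = (k : ℤ) + 1 := ⟨w⁻¹ ((k : ℤ) + 1), app_inv _ _⟩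
  have q0 : 0 < q := famR_pos h (by omega)
  have hqx : q = x := by
    by_cases hqn : q ≤ n
    · rcases lt_trichotomy q x with h1 | h1 | h1
      · exfalso
        apply c3
        refine ⟨by omega, ?_⟩
        rcases lt_or_eq_of_le (show q ≤ x - 1 by omega) with h2 | h2
        · have := h.2.2.1 q (x - 1) q0 h2 (by omega)
          omega
        · rw [← h2]; omega
      · exact h1
      · have := h.2.2.1 x q (by omega) h1 hqn
        omega
    · exfalso
      have hyq : y < q := by
        rcases lt_trichotomy q y with h1 | h1 | h1
        · have := h.2.2.2 q y (by omega) h1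
          omega
        · subst h1; omega
        · exact h1
      apply c2
      refine ⟨c0, ?_⟩
      have hne : w x ≠ w q := fun hh => by have := w.injective hh; omega
      rcases lt_or_eq_of_le (show y + 1 ≤ q by omega) with h2 | h2
      · have := h.2.2.2 (y + 1) q (by omega) h2
        omega
      · rw [h2]; omega
  subst hqx
  have i1 : w⁻¹ ((k : ℤ) + 1) = q := by rw [Perm.inv_eq_iff_eq, hq]
  have i2 : w⁻¹ (lo k) = y := by rw [Perm.inv_eq_iff_eq, hk]; omega
  refine ⟨k, ?_, ?_⟩
  · unfold desc
    rw [i1, i2]; omega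
  · rw [corR, i1, i2, Prod.mk.injEq]; omega

lemma injR {M n : ℕ} {w : Perm ℤ} (k k' : ℕ) (h : famR M n w) (hd : desc k w) (hd' : desc k' w)
    (he : corR n k w = corR n k' w) : k = k' := by
  obtain ⟨A, B, hA, hAB, hk0, _, wA, wB, hc⟩ := descR h hd
  obtain ⟨A', B', hA', hAB', hk0', _, wA', wB', hc'⟩ := descR h hd'
  rw [hc, hc', Prod.mk.injEq] at he
  have : A = A' := by omega
  subst this
  omega

theorem count_straight {M n : ℕ} {w : Perm ℤ} (h : famR M n w) :
    {f | IsStdFilling (cellR n w) (ell w) f}.ncard = N M w := by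
  apply count_ncard (famR M n) (cellR n) (corR n) (fun _ h => h.1) (fun _ _ h => famR_step h)
    (fun _ _ h => corR_corner h) (fun _ _ h => cellR_step h) (fun _ c h => surjR h c)
    (fun _ k k' h => injR k k' h) _ h
  rintro - ⟨a, b⟩ ⟨_, h2⟩
  simp only [Perm.one_apply] at h2
  omega

/-! the two specific shapes -/

theorem count_square (n : ℕ) :
    {f | IsStdFilling (strCell (sqShape n)) (ell (w0 n)) f}.ncard = N (2 * n + 1) (w0 n) := by
  obtain ⟨w, hB, hw, hN, hl⟩ := chain1 n n le_rfl
  have hf : famR (2 * n + 1) n w := by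
    refine ⟨hB.mono (by omega), ?_, ?_, ?_⟩
    · intro i hi
      rw [hw i hi, Wf]; split_ifs <;> omega
    · intro i j hi hij hj
      rw [hw i hi, hw j (by omega), Wf, Wf]; split_ifs <;> omega
    · intro i j hi hij
      rw [hw i (by omega), hw j (by omega), Wf, Wf]; split_ifs <;> omega
  rw [← hN, ← hl, ← count_straight hf]
  have : strCell (sqShape n) = cellR n w := by
    funext ⟨a, b⟩
    apply propext
    unfold strCell cellR sqShape
    dsimp only
    by_cases ha : a < n
    · rw [List.getD_replicate _ ha, hw _ (by omega), hw _ (by omega), Wf, Wf]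
      simp only [ha, true_and]
      split_ifs <;> omega
    · simp only [ha, false_and]
      rw [List.getD_eq_default _ _ (by simp; omega)]
      simp
  rw [this]

theorem count_stair (n : ℕ) :
    {f | IsStdFilling (shiftCell (dblStair n)) (ell (w0 n)) f}.ncard = N (2 * n + 1) (w0 n) := by
  obtain ⟨w, hB, hw, hN, hl⟩ := chain2 n n le_rfl
  rw [Nat.sub_self] at hw
  have hf : famS (2 * n + 1) w := by
    refine ⟨hB.mono (by omega), ?_⟩
    intro i j hi hij
    rw [hw i hi, hw j (by omega), Uf, Uf]
    push_cast
    split_ifs <;> omega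
  rw [← hN, ← hl, ← count_shifted hf]
  have : shiftCell (dblStair n) = cellS w := by
    funext ⟨a, b⟩
    apply propext
    unfold shiftCell cellS dblStair
    dsimp only
    by_cases hab : a ≤ b
    swap
    · simp [hab]
    simp only [hab, true_and]
    rw [hw _ (by omega), hw _ (by omega), Uf, Uf]
    push_cast
    by_cases ha : a < n
    · rw [List.getD_eq_getElem _ _ (by simpa using ha)]
      simp only [List.getElem_map, List.getElem_range]
      split_ifs <;> omega
    · rw [List.getD_eq_default _ _ (by simp; omega)]
      split_ifs <;> omega
  rw [this]

end BW

namespace BW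

open Equiv

lemma cnt_mono {n M : ℕ} (hnM : n ≤ M) : ∀ d v, Bn n v → cnt M d v = cnt n d v := by
  classical
  intro d
  induction d with
  | zero => intro v _; rfl
  | succ d ih =>
    intro v h
    rw [cnt, cnt]
    symm
    have e : ∀ k ∈ Finset.range n, (if desc k v then cnt n d (s k * v) else 0) =
        (if desc k v then cnt M d (s k * v) else 0) := by
      intro k hk
      rw [ih _ ((Bn_s (Finset.mem_range.1 hk)).mul h)]
    rw [Finset.sum_congr rfl e]
    apply Finset.sum_subset
    · intro k hk
      rw [Finset.mem_range] at *
      omega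
    · intro k _ hk
      rw [Finset.mem_range] at hk
      rw [if_neg (not_desc_of_le h (by omega))]

lemma N_mono {n M : ℕ} (hnM : n ≤ M) {v : Perm ℤ} (h : Bn n v) : N M v = N n v :=
  cnt_mono hnM _ v h

lemma ell_w0 (n : ℕ) : ell (w0 n) = n ^ 2 := by
  induction n with
  | zero =>
    have : w0 0 = 1 := by
      ext x
      rw [w0_apply, Perm.one_apply]
      split_ifs <;> push_cast at * <;> omega
    rw [this, ell_one]; rfl
  | succ n ih =>
    have hfin := Inv_finite (Bn_w0 n)
    unfold ell at *
    have e : Inv (w0 (n + 1)) = Inv (w0 n) ∪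
        ↑(((Finset.Icc (-((n : ℤ) + 1)) n).erase 0).image (fun i => (i, (n : ℤ) + 1))) := by
      ext ⟨i, j⟩
      simp only [Inv, Set.mem_union, Set.mem_ofPred_eq, w0_apply, Finset.coe_image, Set.mem_image,
        Finset.mem_coe, Finset.mem_erase, Finset.mem_Icc, Prod.mk.injEq]
      push_cast
      constructor
      · rintro ⟨h1, h2, h3, h4⟩
        by_cases hj : j = n + 1
        · right
          exact ⟨⟨h1, by omega, by omega⟩, rfl, hj.symm⟩
        · left
          refine ⟨h1, h2, h3, ?_⟩
          split_ifs at h4 ⊢ <;> omega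
      · rintro (⟨h1, h2, h3, h4⟩ | ⟨⟨h1, h2, h3⟩, -, rfl⟩)
        · refine ⟨h1, h2, h3, ?_⟩
          split_ifs at h4 ⊢ <;> omega
        · refine ⟨h1, by omega, by omega, ?_⟩
          split_ifs <;> omega
    rw [e, Set.ncard_union_eq ?_ hfin (Finset.finite_toSet _), ih, Set.ncard_coe_finset,
      Finset.card_image_of_injective, Finset.card_erase_of_mem, Int.card_Icc]
    · have : ((n : ℤ) + 1 - -((n : ℤ) + 1)).toNat = 2 * n + 2 := by omega
      rw [this]
      have : 2 * n + 2 - 1 = 2 * n + 1 := by omega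
      rw [this]; ring
    · rw [Finset.mem_Icc]; omega
    · intro x y hxy
      exact (Prod.mk.inj hxy).1
    · rw [Set.disjoint_left]
      rintro ⟨i, j⟩ h1 h2
      simp only [Finset.coe_image, Set.mem_image, Finset.mem_coe, Prod.mk.injEq] at h2
      obtain ⟨x, _, rfl, rfl⟩ := h2
      obtain ⟨h1, h2, h3, h4⟩ := h1
      simp only [w0_apply] at h1 h2 h3 h4
      split_ifs at h4 <;> omega

lemma eq_w0 {n : ℕ} {g : Perm ℤ} (h : Bn n g) (hd : ∀ k, k < n → desc k g) : g = w0 n := by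
  have hw : w0 n * w0 n = 1 := by
    ext x
    rw [Perm.mul_apply, Perm.one_apply, w0_apply, w0_apply]
    split_ifs <;> omega
  have hwi : (w0 n)⁻¹ = w0 n := inv_eq_of_mul_eq_one_left hw
  have : w0 n * g = 1 := by
    by_contra hne
    obtain ⟨k, hk, hdk⟩ := exists_desc ((Bn_w0 n).mul h) hne
    have h2 := hd k hk
    have hl : k = 0 ∧ lo k = -1 ∨ 1 ≤ k ∧ lo k = k := by unfold lo; split_ifs <;> omega
    unfold desc at *
    rw [mul_inv_rev, hwi, Perm.mul_apply, Perm.mul_apply, w0_apply, w0_apply, if_pos (by omega),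
      if_pos (by omega), h.inv.1, h.inv.1] at hdk
    omega
  have := eq_inv_of_mul_eq_one_right this
  rw [this, hwi]

/-! relations -/

lemma lo_pos {k : ℕ} (hk : 1 ≤ k) : lo k = k := by unfold lo; rw [if_neg (by omega)]

lemma s_comm {k l : ℕ} (h : k + 2 ≤ l) : s k * s l = s l * s k := by
  have h1 : s k (lo l) = lo l := by
    have := lo_pos (k := l) (by omega)
    have := lo_lt k
    rw [s_apply]
    unfold lo at *
    split_ifs at * <;> omega
  have h2 : s k ((l : ℤ) + 1) = l + 1 := by
    rw [s_apply]
    unfold lo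
    split_ifs <;> omega
  have := conj (Bn_s (Nat.lt_succ_self k)) (lo l) ((l : ℤ) + 1)
  rw [h1, h2] at this
  exact this

lemma T_congr_s {k : ℕ} (hk : 1 ≤ k) : s k = T k (k + 1) := by rw [s, lo_pos hk]

lemma s_braid3 {k : ℕ} (hk : 1 ≤ k) : s k * s (k + 1) * s k = s (k + 1) * s k * s (k + 1) := by
  have B1 := Bn_s (Nat.lt_succ_self k)
  have B2 := Bn_s (Nat.lt_succ_self (k + 1))
  have e1 : s k * s (k + 1) = T k (k + 2) * s k := by
    have := conj B1 (lo (k + 1)) (((k + 1 : ℕ) : ℤ) + 1)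
    rw [lo_pos (by omega), s_apply k, s_apply k, lo_pos hk] at this
    push_cast at this
    rw [if_neg (by omega), if_pos rfl, if_neg (by omega), if_neg (by omega), if_neg (by omega),
      if_neg (by omega)] at this
    rw [T_congr_s (k := k + 1) (by omega)]
    push_cast
    rw [this, add_assoc]; rfl
  have e2 : s (k + 1) * s k = T k (k + 2) * s (k + 1) := by
    have := conj B2 (lo k) ((k : ℤ) + 1)
    rw [lo_pos hk, s_apply (k + 1), s_apply (k + 1), lo_pos (by omega)] at this
    push_cast at this
    rw [if_neg (by omega), if_neg (by omega), if_neg (by omega), if_neg (by omega),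
      if_pos rfl] at this
    rw [T_congr_s hk, this, add_assoc]; rfl
  rw [e1, e2, mul_assoc, mul_assoc, s_mul_self, s_mul_self]

lemma s_zero_apply (x : ℤ) : s 0 x = if x = -1 then 1 else if x = 1 then -1 else x := by
  rw [s_apply]; unfold lo
  simp only [if_true]
  split_ifs <;> push_cast at * <;> omega

lemma s_one_apply (x : ℤ) : s 1 x = if x = 1 then 2 else if x = 2 then 1 else
    if x = -1 then -2 else if x = -2 then -1 else x := by
  rw [s_apply, lo_pos le_rfl]
  push_cast
  split_ifs <;> omega

lemma s_braid4 : s 0 * s 1 * s 0 * s 1 = s 1 * s 0 * s 1 * s 0 := by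
  ext x
  simp only [Perm.mul_apply]
  by_cases h1 : x = 1
  · subst h1; simp [s_zero_apply, s_one_apply]
  by_cases h2 : x = -1
  · subst h2; simp [s_zero_apply, s_one_apply]
  by_cases h3 : x = 2
  · subst h3; simp [s_zero_apply, s_one_apply]
  by_cases h4 : x = -2
  · subst h4; simp [s_zero_apply, s_one_apply]
  have e0 : s 0 x = x := by rw [s_zero_apply, if_neg h2, if_neg h1]
  have e1 : s 1 x = x := by rw [s_one_apply, if_neg h1, if_neg h3, if_neg h2, if_neg h4]
  rw [e1, e0, e1, e0, e1]

section rel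
variable {G : Type*} [Group G] {x y : G}

lemma rel2 (hx : x * x = 1) (hy : y * y = 1) : (x * y) ^ 2 = 1 ↔ x * y = y * x := by
  have hx' : x⁻¹ = x := inv_eq_of_mul_eq_one_left hx
  have hy' : y⁻¹ = y := inv_eq_of_mul_eq_one_left hy
  rw [pow_two, mul_eq_one_iff_eq_inv, mul_inv_rev, hx', hy']

lemma rel3 (hx : x * x = 1) (hy : y * y = 1) : (x * y) ^ 3 = 1 ↔ x * y * x = y * x * y := by
  have hx' : x⁻¹ = x := inv_eq_of_mul_eq_one_left hx
  have hy' : y⁻¹ = y := inv_eq_of_mul_eq_one_left hy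
  have e : (x * y) ^ 3 = (x * y * x) * (y * x * y) := by simp only [pow_succ, pow_zero, one_mul, mul_assoc]
  rw [e, mul_eq_one_iff_eq_inv, mul_inv_rev, mul_inv_rev, hx', hy', ← mul_assoc]

lemma rel4 (hx : x * x = 1) (hy : y * y = 1) :
    (x * y) ^ 4 = 1 ↔ x * y * x * y = y * x * y * x := by
  have hx' : x⁻¹ = x := inv_eq_of_mul_eq_one_left hx
  have hy' : y⁻¹ = y := inv_eq_of_mul_eq_one_left hy
  have e : (x * y) ^ 4 = (x * y * x * y) * (x * y * x * y) := by
    simp only [pow_succ, pow_zero, one_mul, mul_assoc]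
  rw [e, mul_eq_one_iff_eq_inv, mul_inv_rev, mul_inv_rev, mul_inv_rev, hx', hy', ← mul_assoc,
    ← mul_assoc]

end rel

/-! descents in dihedral parabolics -/

lemma desc_far {k l : ℕ} {g : Perm ℤ} {n : ℕ} (h : Bn n g) (hk : k < n) (hl : l < n)
    (hkl : k + 2 ≤ l) (dk : desc k g) (dl : desc l g) : ell g = ell (s l * (s k * g)) + 2 := by
  have e1 := ell_desc h hk dk
  have : desc l (s k * g) := by
    unfold desc at *
    rw [mul_inv_rev, s_inv, Perm.mul_apply, Perm.mul_apply]
    have h1 : s k (lo l) = lo l := by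
      have := lo_pos (k := l) (by omega)
      have := lo_lt k
      rw [s_apply]
      unfold lo at *
      split_ifs at * <;> omega
    have h2 : s k ((l : ℤ) + 1) = l + 1 := by
      rw [s_apply]
      unfold lo
      split_ifs <;> omega
    rwa [h1, h2]
  have e2 := ell_desc ((Bn_s hk).mul h) hl this
  omega

lemma desc_three {k : ℕ} {g : Perm ℤ} {n : ℕ} (h : Bn n g) (hk : 1 ≤ k) (hl : k + 1 < n)
    (dk : desc k g) (dl : desc (k + 1) g) :
    ell g = ell (s k * (s (k + 1) * (s k * g))) + 3 := by
  have hkn : k < n := by omega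
  have e1 := ell_desc h hkn dk
  have l1 := lo_pos hk
  have l2 : lo (k + 1) = k + 1 := by rw [lo_pos (by omega)]; push_cast; rfl
  have a1 : s k ((k : ℤ) + 1) = k := by rw [s_hi, l1]
  have a2 : s k (k : ℤ) = k + 1 := by
    rw [s_apply, l1]; simp
  have a3 : s k ((k : ℤ) + 1 + 1) = k + 1 + 1 := by
    rw [s_apply, l1]; split_ifs <;> omega
  have b1 : s (k + 1) ((k : ℤ) + 1) = k + 1 + 1 := by
    rw [s_apply, l2]; simp
  have b2 : s (k + 1) (k : ℤ) = k := by
    rw [s_apply, l2]; push_cast; split_ifs <;> omega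
  unfold desc at dk dl
  rw [l1] at dk
  rw [l2] at dl
  push_cast at dl
  have d2 : desc (k + 1) (s k * g) := by
    unfold desc
    rw [mul_inv_rev, s_inv, Perm.mul_apply, Perm.mul_apply, l2]
    push_cast
    rw [a1, a3]
    omega
  have d3 : desc k (s (k + 1) * (s k * g)) := by
    unfold desc
    rw [mul_inv_rev, mul_inv_rev, s_inv, s_inv, Perm.mul_apply, Perm.mul_apply, Perm.mul_apply,
      Perm.mul_apply, l1, b1, b2, a2, a3]
    omega
  have e2 := ell_desc ((Bn_s hkn).mul h) hl d2
  have e3 := ell_desc ((Bn_s hl).mul ((Bn_s hkn).mul h)) hkn d3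
  omega

lemma desc_four {g : Perm ℤ} {n : ℕ} (h : Bn n g) (hl : 1 < n)
    (dk : desc 0 g) (dl : desc 1 g) :
    ell g = ell (s 1 * (s 0 * (s 1 * (s 0 * g)))) + 4 := by
  have hkn : 0 < n := by omega
  have e1 := ell_desc h hkn dk
  have hi := h.inv.1
  have E0 : ∀ v, desc 0 v ↔ v⁻¹ 1 < v⁻¹ (-1) := by intro v; unfold desc lo; simp
  have E1 : ∀ v, desc 1 v ↔ v⁻¹ 2 < v⁻¹ 1 := by intro v; unfold desc lo; simp
  rw [E0, hi] at dk
  rw [E1] at dl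
  have z1 : s 0 1 = -1 := rfl
  have z2 : s 0 2 = 2 := rfl
  have z3 : s 0 (-1) = 1 := rfl
  have z4 : s 0 (-2) = -2 := rfl
  have y1 : s 1 1 = 2 := rfl
  have y2 : s 1 2 = 1 := rfl
  have y3 : s 1 (-1) = -2 := rfl
  have y4 : s 1 (-2) = -1 := rfl
  have d2 : desc 1 (s 0 * g) := by
    rw [E1, mul_inv_rev, s_inv]
    simp only [Perm.mul_apply, z1, z2, z3, z4, y1, y2, y3, y4, hi]
    omega
  have d3 : desc 0 (s 1 * (s 0 * g)) := by
    rw [E0, mul_inv_rev, mul_inv_rev, s_inv, s_inv]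
    simp only [Perm.mul_apply, z1, z2, z3, z4, y1, y2, y3, y4, hi]
    omega
  have d4 : desc 1 (s 0 * (s 1 * (s 0 * g))) := by
    rw [E1, mul_inv_rev, mul_inv_rev, mul_inv_rev, s_inv, s_inv]
    simp only [Perm.mul_apply, z1, z2, z3, z4, y1, y2, y3, y4, hi]
    omega
  have e2 := ell_desc ((Bn_s hkn).mul h) hl d2
  have e3 := ell_desc ((Bn_s hl).mul ((Bn_s hkn).mul h)) hkn d3
  have e4 := ell_desc ((Bn_s hkn).mul ((Bn_s hl).mul ((Bn_s hkn).mul h))) hl d4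
  omega

/-! words -/

/-- letter translation -/
def kap {n : ℕ} (i : Fin n) : ℕ := n - 1 - i

lemma kap_lt {n : ℕ} (i : Fin n) : kap i < n := by unfold kap; omega

lemma kap_inj {n : ℕ} {i j : Fin n} (h : kap i = kap j) : i = j := by
  unfold kap at h; apply Fin.ext; omega

lemma kap_surj {n k : ℕ} (hk : k < n) : ∃ i : Fin n, kap i = k :=
  ⟨⟨n - 1 - k, by omega⟩, by simp only [kap]; omega⟩

/-- product of a word -/
def pp {n : ℕ} (ω : List (Fin n)) : Perm ℤ := (ω.map (fun i => s (kap i))).prod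

lemma pp_nil {n : ℕ} : pp ([] : List (Fin n)) = 1 := rfl

lemma pp_cons {n : ℕ} (a : Fin n) (ω : List (Fin n)) : pp (a :: ω) = s (kap a) * pp ω := by
  simp [pp]

lemma Bn_pp {n : ℕ} (ω : List (Fin n)) : Bn n (pp ω) := by
  induction ω with
  | nil => exact Bn.one n
  | cons a ω ih => rw [pp_cons]; exact (Bn_s (kap_lt a)).mul ih

lemma ell_pp_le {n : ℕ} (ω : List (Fin n)) : ell (pp ω) ≤ ω.length := by
  induction ω with
  | nil => rw [pp_nil, ell_one]; simp
  | cons a ω ih =>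
    rw [pp_cons, List.length_cons]
    by_cases hd : desc (kap a) (pp ω)
    · have := ell_desc (Bn_pp ω) (kap_lt a) hd; omega
    · have := ell_asc (Bn_pp ω) (kap_lt a) hd; omega

lemma exists_word {n : ℕ} : ∀ d g, Bn n g → ell g = d →
    ∃ ω : List (Fin n), ω.length = d ∧ pp ω = g := by
  intro d
  induction d with
  | zero =>
    intro g h hd
    exact ⟨[], rfl, (eq_one_of_ell h hd).symm⟩
  | succ d ih =>
    intro g h hd
    have hg : g ≠ 1 := by rintro rfl; rw [ell_one] at hd; omega
    obtain ⟨k, hk, hdk⟩ := exists_desc h hg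
    have := ell_desc h hk hdk
    obtain ⟨ω, h1, h2⟩ := ih (s k * g) ((Bn_s hk).mul h) (by omega)
    obtain ⟨i, rfl⟩ := kap_surj hk
    exact ⟨i :: ω, by simp [h1], by rw [pp_cons, h2, s_mul_s_mul]⟩

lemma cons_red {n d : ℕ} {g : Perm ℤ} (h : Bn n g) (hg : ell g = d + 1) {a : Fin n}
    {ω : List (Fin n)} (hl : (a :: ω).length = d + 1) (hp : pp (a :: ω) = g) :
    desc (kap a) g ∧ ω.length = d ∧ pp ω = s (kap a) * g ∧ ell (s (kap a) * g) = d := by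
  have e : pp ω = s (kap a) * g := by rw [← hp, pp_cons, s_mul_s_mul]
  have hl' : ω.length = d := by simpa using hl
  have h1 := ell_pp_le ω
  rw [e] at h1
  have h2 : desc (kap a) g := by rw [desc_iff h (kap_lt a)]; omega
  have := ell_desc h (kap_lt a) h2
  exact ⟨h2, hl', e, by omega⟩

open Classical in
theorem count_words {n : ℕ} : ∀ d g, Bn n g → ell g = d →
    ∃ S : Finset (List (Fin n)), (∀ ω, ω ∈ S ↔ ω.length = d ∧ pp ω = g) ∧ S.card = N n g := by
  intro d
  induction d with
  | zero =>
    intro g h hd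
    have := eq_one_of_ell h hd
    subst this
    refine ⟨{[]}, ?_, ?_⟩
    · intro ω
      rw [Finset.mem_singleton]
      constructor
      · rintro rfl; exact ⟨rfl, rfl⟩
      · rintro ⟨h1, _⟩; exact List.length_eq_zero_iff.1 h1
    · rw [N_one]; simp
  | succ d ih =>
    intro g h hd
    have hg : g ≠ 1 := by rintro rfl; rw [ell_one] at hd; omega
    have ih' : ∀ a : Fin n, ∃ S : Finset (List (Fin n)), desc (kap a) g →
        ((∀ ω, ω ∈ S ↔ ω.length = d ∧ pp ω = s (kap a) * g) ∧ S.card = N n (s (kap a) * g)) := by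
      intro a
      by_cases hk : desc (kap a) g
      · have := ell_desc h (kap_lt a) hk
        obtain ⟨S, hS⟩ := ih (s (kap a) * g) ((Bn_s (kap_lt a)).mul h) (by omega)
        exact ⟨S, fun _ => hS⟩
      · exact ⟨∅, fun hh => absurd hh hk⟩
    choose S hS using ih'
    refine ⟨((Finset.univ : Finset (Fin n)).filter (fun a => desc (kap a) g)).biUnion
      (fun a => (S a).image (fun ω => a :: ω)), ?_, ?_⟩
    · intro ω
      simp only [Finset.mem_biUnion, Finset.mem_filter, Finset.mem_univ, true_and,
        Finset.mem_image]
      constructor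
      · rintro ⟨a, ha, ω', hω', rfl⟩
        rw [(hS a ha).1] at hω'
        exact ⟨by simp [hω'.1], by rw [pp_cons, hω'.2, s_mul_s_mul]⟩
      · rintro ⟨h1, h2⟩
        rcases ω with _ | ⟨a, ω⟩
        · simp at h1
        · obtain ⟨c1, c2, c3, _⟩ := cons_red h hd h1 h2
          exact ⟨a, c1, ω, (hS a c1).1 ω |>.2 ⟨c2, c3⟩, rfl⟩
    · rw [Finset.card_biUnion]
      · rw [Finset.sum_filter, N_rec h hg, ← Finset.sum_range_reflect, ← Fin.sum_univ_eq_sum_range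
          (fun j => if desc (n - 1 - j) g then N n (s (n - 1 - j) * g) else 0)]
        apply Finset.sum_congr rfl
        intro a _
        change (if desc (kap a) g then _ else _) = if desc (kap a) g then N n (s (kap a) * g) else 0
        by_cases hk : desc (kap a) g
        · rw [if_pos hk, if_pos hk, Finset.card_image_of_injective, (hS a hk).2]
          intro x y hxy
          exact (List.cons.inj hxy).2
        · rw [if_neg hk, if_neg hk]
      · intro a _ b _ hab
        rw [Function.onFun, Finset.disjoint_left]
        intro ω h1 h2
        rw [Finset.mem_image] at h1 h2
        obtain ⟨x, _, rfl⟩ := h1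
        obtain ⟨y, _, hy⟩ := h2
        exact hab (List.cons.inj hy).1.symm

end BW

namespace BW

open Equiv

/-! the Coxeter group -/

section cox
variable {W : Type*} [Group W] {n : ℕ} (cs : CoxeterSystem (CoxeterMatrix.B n) W)

lemma B_apply (i j : Fin n) : (CoxeterMatrix.B n).M i j =
    if i = j then 1
      else (if (i : ℕ) = n - 1 ∧ (j : ℕ) = n - 2 ∨ (j : ℕ) = n - 1 ∧ (i : ℕ) = n - 2 then 4
        else (if (j : ℕ) + 1 = i ∨ (i : ℕ) + 1 = j then 3 else 2)) := rfl

lemma B_two {a b : Fin n} (h : kap a + 2 ≤ kap b) : (CoxeterMatrix.B n).M a b = 2 := by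
  have := a.2
  have := b.2
  unfold kap at h
  rw [B_apply, if_neg (by rintro rfl; omega), if_neg (by omega), if_neg (by omega)]

lemma B_three {a b : Fin n} (h1 : 1 ≤ kap a) (h : kap b = kap a + 1) :
    (CoxeterMatrix.B n).M a b = 3 := by
  have := a.2
  have := b.2
  unfold kap at h h1
  rw [B_apply, if_neg (by rintro rfl; omega), if_neg (by omega), if_pos (by omega)]

lemma B_four {a b : Fin n} (h1 : kap a = 0) (h : kap b = 1) :
    (CoxeterMatrix.B n).M a b = 4 := by
  have := a.2
  have := b.2
  unfold kap at h h1
  rw [B_apply, if_neg (by rintro rfl; omega), if_pos (by omega)]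

lemma W_two {a b : Fin n} (h : kap a + 2 ≤ kap b) :
    cs.simple a * cs.simple b = cs.simple b * cs.simple a := by
  have := cs.simple_mul_simple_pow a b
  rw [B_two h] at this
  exact (rel2 (cs.simple_mul_simple_self a) (cs.simple_mul_simple_self b)).1 this

lemma W_three {a b : Fin n} (h1 : 1 ≤ kap a) (h : kap b = kap a + 1) :
    cs.simple a * cs.simple b * cs.simple a = cs.simple b * cs.simple a * cs.simple b := by
  have := cs.simple_mul_simple_pow a b
  rw [B_three h1 h] at this
  exact (rel3 (cs.simple_mul_simple_self a) (cs.simple_mul_simple_self b)).1 this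

lemma W_four {a b : Fin n} (h1 : kap a = 0) (h : kap b = 1) :
    cs.simple a * cs.simple b * cs.simple a * cs.simple b =
      cs.simple b * cs.simple a * cs.simple b * cs.simple a := by
  have := cs.simple_mul_simple_pow a b
  rw [B_four h1 h] at this
  exact (rel4 (cs.simple_mul_simple_self a) (cs.simple_mul_simple_self b)).1 this

lemma pow_le {a b : Fin n} (h : kap a ≤ kap b) :
    (s (kap a) * s (kap b)) ^ (CoxeterMatrix.B n).M a b = 1 := by
  rcases Nat.lt_or_ge (kap a + 1) (kap b) with h1 | h1
  · rw [B_two h1, rel2 (s_mul_self _) (s_mul_self _)]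
    exact s_comm h1
  rcases eq_or_lt_of_le h with h2 | h2
  · have := kap_inj h2
    subst this
    rw [CoxeterMatrix.diagonal, pow_one, s_mul_self]
  · have h3 : kap b = kap a + 1 := by omega
    rcases Nat.eq_zero_or_pos (kap a) with h4 | h4
    · rw [B_four h4 (by omega), rel4 (s_mul_self _) (s_mul_self _), h3, h4]
      exact s_braid4
    · rw [B_three h4 h3, rel3 (s_mul_self _) (s_mul_self _), h3]
      exact s_braid3 h4

lemma liftable : (CoxeterMatrix.B n).IsLiftable (fun i : Fin n => s (kap i)) := by
  intro a b
  rcases le_total (kap a) (kap b) with h | h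
  · exact pow_le h
  · have h1 := pow_le h
    have e : (CoxeterMatrix.B n).M b a = (CoxeterMatrix.B n).M a b :=
      (CoxeterMatrix.B n).symmetric b a
    rw [e] at h1
    have h2 := congrArg (fun x => x⁻¹) h1
    simp only [← inv_pow, mul_inv_rev, s_inv, inv_one] at h2
    exact h2

/-- the representation by signed permutations -/
noncomputable def phi : W →* Perm ℤ := cs.lift ⟨_, liftable⟩

lemma phi_word (ω : List (Fin n)) : phi cs (cs.wordProd ω) = pp ω := by
  induction ω with
  | nil => rw [cs.wordProd_nil, map_one, pp_nil]
  | cons a ω ih =>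
    rw [cs.wordProd_cons, map_mul, ih, pp_cons]
    congr 1
    exact cs.lift_apply_simple liftable a

/-- The theorem of Matsumoto for this group. -/
lemma matsumoto : ∀ d g, Bn n g → ell g = d → ∀ ω ω' : List (Fin n), ω.length = d →
    ω'.length = d → pp ω = g → pp ω' = g → cs.wordProd ω = cs.wordProd ω' := by
  intro d
  induction d with
  | zero =>
    intro g _ _ ω ω' h1 h2 _ _
    rw [List.length_eq_zero_iff.1 h1, List.length_eq_zero_iff.1 h2]
  | succ d ih =>
    intro g h hd
    -- main case
    have main : ∀ (a b : Fin n) (ω ω' : List (Fin n)), kap a < kap b →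
        (a :: ω).length = d + 1 → (b :: ω').length = d + 1 → pp (a :: ω) = g → pp (b :: ω') = g →
        cs.wordProd (a :: ω) = cs.wordProd (b :: ω') := by
      intro a b ω ω' hab h1 h2 h3 h4
      obtain ⟨da, la, pa, ea⟩ := cons_red h hd h1 h3
      obtain ⟨db, lb, pb, eb⟩ := cons_red h hd h2 h4
      have Ba := Bn_s (kap_lt a)
      have Bb := Bn_s (kap_lt b)
      rcases Nat.lt_or_ge (kap a + 1) (kap b) with hc | hc
      · have e := desc_far h (kap_lt a) (kap_lt b) hc da db
        obtain ⟨η, hη, pη⟩ := exists_word _ _ (Bb.mul (Ba.mul h)) rfl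
        have q1 := ih _ (Ba.mul h) ea ω (b :: η) la (by simp [hη]; omega) pa
          (by rw [pp_cons, pη, s_mul_s_mul])
        have q2 := ih _ (Bb.mul h) eb ω' (a :: η) lb (by simp [hη]; omega) pb
          (by rw [pp_cons, pη, ← mul_assoc, ← mul_assoc, s_comm hc, mul_assoc (s (kap b)),
                s_mul_self, mul_one])
        rw [cs.wordProd_cons, cs.wordProd_cons, q1, q2, cs.wordProd_cons, cs.wordProd_cons,
          ← mul_assoc, ← mul_assoc, W_two cs hc]
      have h3 : kap b = kap a + 1 := by omega
      rcases Nat.eq_zero_or_pos (kap a) with h4 | h4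
      · have h5 : kap b = 1 := by omega
        have kb := kap_lt b
        rw [h5] at kb
        have W4 := W_four cs h4 h5
        rw [h4] at da pa ea Ba
        rw [h5] at db pb eb Bb
        have e := desc_four h kb da db
        obtain ⟨η, hη, pη⟩ := exists_word _ _ (Bb.mul (Ba.mul (Bb.mul (Ba.mul h)))) rfl
        have q1 := ih _ (Ba.mul h) ea ω (b :: a :: b :: η) la (by simp [hη]; omega) pa
          (by simp only [pp_cons, pη, h4, h5, s_mul_s_mul])
        have q2 := ih _ (Bb.mul h) eb ω' (a :: b :: a :: η) lb (by simp [hη]; omega) pb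
          (by
            have z : s 1 * (s 0 * (s 1 * (s 0 * g))) = s 0 * (s 1 * (s 0 * (s 1 * g))) := by
              have := s_braid4
              simp only [← mul_assoc]
              rw [this]
            simp only [pp_cons, pη, h4, h5]
            rw [z]
            simp only [s_mul_s_mul])
        rw [cs.wordProd_cons, cs.wordProd_cons, q1, q2]
        simp only [cs.wordProd_cons, ← mul_assoc]
        rw [W4]
      · have W3 := W_three cs h4 h3
        have kb := kap_lt b
        rw [h3] at kb db pb eb Bb
        have e := desc_three h h4 kb da db
        obtain ⟨η, hη, pη⟩ := exists_word _ _ (Ba.mul (Bb.mul (Ba.mul h))) rfl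
        have q1 := ih _ (Ba.mul h) ea ω (b :: a :: η) la (by simp [hη]; omega) pa
          (by simp only [pp_cons, pη, h3, s_mul_s_mul])
        have q2 := ih _ (Bb.mul h) eb ω' (a :: b :: η) lb (by simp [hη]; omega) pb
          (by
            have z : s (kap a) * (s (kap a + 1) * (s (kap a) * g)) =
                s (kap a + 1) * (s (kap a) * (s (kap a + 1) * g)) := by
              have := s_braid3 h4
              simp only [← mul_assoc]
              rw [this]
            simp only [pp_cons, pη, h3]
            rw [z]
            simp only [s_mul_s_mul])
        rw [cs.wordProd_cons, cs.wordProd_cons, q1, q2]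
        simp only [cs.wordProd_cons, ← mul_assoc]
        rw [W3]
    intro ω ω' h1 h2 h3 h4
    rcases ω with _ | ⟨a, ω⟩
    · simp at h1
    rcases ω' with _ | ⟨b, ω'⟩
    · simp at h2
    rcases lt_trichotomy (kap a) (kap b) with hab | hab | hab
    · exact main a b ω ω' hab h1 h2 h3 h4
    · have := kap_inj hab
      subst this
      obtain ⟨da, la, pa, ea⟩ := cons_red h hd h1 h3
      obtain ⟨db, lb, pb, eb⟩ := cons_red h hd h2 h4
      rw [cs.wordProd_cons, cs.wordProd_cons,
        ih _ ((Bn_s (kap_lt a)).mul h) ea ω ω' la lb pa pb]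
    · exact (main b a ω' ω hab h2 h1 h4 h3).symm

lemma normal_form (ω : List (Fin n)) : ∃ η : List (Fin n), η.length = ell (pp ω) ∧
    pp η = pp ω ∧ cs.wordProd η = cs.wordProd ω := by
  induction ω with
  | nil => exact ⟨[], by rw [pp_nil, ell_one]; rfl, rfl, rfl⟩
  | cons a ω ih =>
    obtain ⟨η, h1, h2, h3⟩ := ih
    by_cases hd : desc (kap a) (pp ω)
    · have e := ell_desc (Bn_pp ω) (kap_lt a) hd
      have hB := (Bn_s (kap_lt a)).mul (Bn_pp ω)
      obtain ⟨ζ, z1, z2⟩ := exists_word _ _ hB rfl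
      refine ⟨ζ, by rw [pp_cons, z1], by rw [pp_cons, z2], ?_⟩
      have := matsumoto cs _ _ (Bn_pp ω) rfl η (a :: ζ) h1 (by simp [z1, e]) h2
        (by rw [pp_cons, z2, s_mul_s_mul])
      rw [cs.wordProd_cons, ← h3, this, cs.wordProd_cons, cs.simple_mul_simple_cancel_left]
    · have e := ell_asc (Bn_pp ω) (kap_lt a) hd
      refine ⟨a :: η, ?_, by rw [pp_cons, pp_cons, h2], by
        rw [cs.wordProd_cons, cs.wordProd_cons, h3]⟩
      rw [List.length_cons, pp_cons, h1, e]

lemma wordProd_eq_of_pp {ω ω' : List (Fin n)} (h : pp ω = pp ω') :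
    cs.wordProd ω = cs.wordProd ω' := by
  obtain ⟨η, h1, h2, h3⟩ := normal_form cs ω
  obtain ⟨η', h1', h2', h3'⟩ := normal_form cs ω'
  rw [← h3, ← h3']
  exact matsumoto cs _ _ (Bn_pp ω) rfl η η' h1 (by rw [h1', h]) h2 (by rw [h2', h])

lemma length_eq (w : W) : cs.length w = ell (phi cs w) := by
  obtain ⟨ω, hr, rfl⟩ := cs.exists_isReduced w
  rw [phi_word]
  obtain ⟨η, h1, h2, h3⟩ := normal_form cs ω
  apply le_antisymm
  · rw [← h1, ← h3]
    exact cs.length_wordProd_le η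
  · rw [hr.eq]
    exact ell_pp_le ω

lemma phi_longest (w : W) (hw : ∀ u : W, cs.length u ≤ cs.length w) : phi cs w = w0 n := by
  obtain ⟨ω, hr, rfl⟩ := cs.exists_isReduced w
  have hB := Bn_pp ω
  rw [phi_word]
  apply eq_w0 hB
  intro k hk
  by_contra hd
  have e := ell_asc hB hk hd
  obtain ⟨a, rfl⟩ := kap_surj hk
  have := hw (cs.wordProd (a :: ω))
  rw [length_eq, length_eq, phi_word, phi_word, pp_cons] at this
  omega

theorem count_reduced (w : W) (hw : ∀ u : W, cs.length u ≤ cs.length w) :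
    {ω : List (Fin n) | cs.IsReduced ω ∧ cs.wordProd ω = w}.ncard = N (2 * n + 1) (w0 n) := by
  obtain ⟨S, hS, hc⟩ := count_words (n := n) _ (w0 n) (Bn_w0 n) rfl
  rw [N_mono (by omega) (Bn_w0 n), ← hc, ← Set.ncard_coe_finset]
  congr 1
  ext ω
  rw [Finset.mem_coe, hS, Set.mem_ofPred_eq]
  have hl := phi_longest cs w hw
  constructor
  · rintro ⟨h1, rfl⟩
    rw [phi_word] at hl
    refine ⟨?_, hl⟩
    rw [← h1.eq, length_eq, phi_word, hl]
  · rintro ⟨h1, h2⟩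
    refine ⟨?_, ?_⟩
    · unfold CoxeterSystem.IsReduced
      rw [length_eq, phi_word, h2, h1]
    · obtain ⟨ω', hr, rfl⟩ := cs.exists_isReduced w
      rw [phi_word] at hl
      exact wordProd_eq_of_pp cs (h2.trans hl.symm)

end cox

end BW

/-- The number of reduced words for the longest element `w₀` of the Coxeter group of type
`Bₙ` equals the number of standard Young tableaux of `n × n` square shape, which in turn
equals the number of standard shifted Young tableaux of doubled staircase shape
`(2n-1, 2n-3, …, 1)`. -/
theorem card_reduced_words_eq_card_square_eq_card_staircase
    {W : Type*} [Group W] (n : ℕ)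
    (cs : CoxeterSystem (CoxeterMatrix.Bₙ n) W) (w0 : W)
    (hw0 : ∀ u : W, cs.length u ≤ cs.length w0) :
    {ω : List (Fin n) | cs.IsReduced ω ∧ cs.wordProd ω = w0}.ncard =
      {f : (ℕ × ℕ) → ℕ | IsStdFilling (strCell (sqShape n)) (n ^ 2) f}.ncard ∧
    {f : (ℕ × ℕ) → ℕ | IsStdFilling (strCell (sqShape n)) (n ^ 2) f}.ncard =
      {f : (ℕ × ℕ) → ℕ | IsStdFilling (shiftCell (dblStair n)) (n ^ 2) f}.ncard := by
  have h1 := BW.count_square n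
  have h2 := BW.count_stair n
  rw [BW.ell_w0] at h1 h2
  rw [h1, h2]
  exact ⟨BW.count_reduced (n := n) cs w0 hw0, rfl⟩
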